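/- arXiv:2407.07679 — 2 statements merged into one kernel-verified Lean document; each statement's English description precedes it below -/
import Mathlib

section
/- For ℓ ≥ 2, set X^∘ := X^{(1)}X^{(2)}···X^{(ℓ)} (matrix product over D_ℓ) and ^LỸ^{(1)} := I + X^{(1)}D^{(1)}. Then the following identities hold in D_ℓ: (i) R_{21} X^∘_1 R X^∘_2 = X^∘_2 R_{21} X^∘_1 R; (ii) R^{−1} (^LỸ^{(1)})_1 R_{21}^{−1} (^LỸ^{(1)})_2 = (^LỸ^{(1)})_2 R^{−1} (^LỸ^{(1)})_1 R_{21}^{−1}; (iii) (^LỸ^{(1)})_1 R_{21}^{−1} X^∘_2 R_{21} = R X^∘_2 R_{21} (^LỸ^{(1)})_1. (These are the defining relations of the fourth-quadrant quantum differential operator algebra under A ↦ X^∘, B^{−1} ↦ ^LỸ^{(1)}.) -/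
noncomputable section
open scoped BigOperators

namespace Rmatrix

/-- The base field `ℂ(q)`. -/
abbrev K : Type := RatFunc ℂ

/-- The parameter `q`. -/
def qq : K := RatFunc.X

/-- Row/column index type for `M_n ⊗ M_n`. -/
abbrev Idx (n : ℕ) := Fin n × Fin n

/-- The `R`-matrix
`R = q Σᵢ Eᵢᵢ⊗Eᵢᵢ + Σ_{i≠j} Eᵢᵢ⊗Eⱼⱼ + (q−q⁻¹) Σ_{i>j} Eⱼᵢ⊗Eᵢⱼ`. -/
def Rm (n : ℕ) : Matrix (Idx n) (Idx n) K := fun p r =>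
  (if p.1 = r.1 ∧ p.2 = r.2 ∧ p.1 = p.2 then qq else 0) +
  (if p.1 = r.1 ∧ p.2 = r.2 ∧ p.1 ≠ p.2 then 1 else 0) +
  (if p.1 = r.2 ∧ p.2 = r.1 ∧ p.1 < p.2 then qq - qq⁻¹ else 0)

/-- `R₂₁`, the `R`-matrix with the two tensor factors swapped. -/
def Rm21 (n : ℕ) : Matrix (Idx n) (Idx n) K := fun p r => Rm n (p.2, p.1) (r.2, r.1)

variable (n : ℕ) (A : Type) [Ring A] [Algebra K A]

/-- A scalar matrix viewed as a matrix with entries in the `K`-algebra `A`. -/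
def ext (M : Matrix (Idx n) (Idx n) K) : Matrix (Idx n) (Idx n) A :=
  M.map (algebraMap K A)

/-- `M₁ = Σ E_ij ⊗ I ⊗ m_ij`, the matrix `M` placed in the first tensor factor. -/
def m1 (M : Matrix (Fin n) (Fin n) A) : Matrix (Idx n) (Idx n) A :=
  fun p r => if p.2 = r.2 then M p.1 r.1 else 0

/-- `M₂ = Σ I ⊗ E_ij ⊗ m_ij`, the matrix `M` placed in the second tensor factor. -/
def m2 (M : Matrix (Fin n) (Fin n) A) : Matrix (Idx n) (Idx n) A :=
  fun p r => if p.1 = r.1 then M p.2 r.2 else 0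

/-- `Ω = Σ_{ij} E_ij ⊗ E_ji ⊗ 1`. -/
def Om : Matrix (Idx n) (Idx n) A := fun p r => if p.1 = r.2 ∧ p.2 = r.1 then 1 else 0

end Rmatrix

namespace Dell

open Rmatrix

variable (ℓ n : ℕ)

/-- Generators `x_ij^{(a)}`, `∂_ij^{(a)}` of `D_ℓ`, for `a ∈ ℤ/ℓℤ`. -/
inductive Gen (ℓ n : ℕ) : Type
  | x : ZMod ℓ → Fin n → Fin n → Gen ℓ n
  | d : ZMod ℓ → Fin n → Fin n → Gen ℓ n

abbrev F (ℓ n : ℕ) := FreeAlgebra K (Gen ℓ n)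

/-- The matrix `X^{(a)}` of generators, over the free algebra. -/
def XF (a : ZMod ℓ) : Matrix (Fin n) (Fin n) (F ℓ n) :=
  fun i j => FreeAlgebra.ι K (Gen.x a i j)

/-- The matrix `D^{(a)}` of generators, over the free algebra. -/
def DF (a : ZMod ℓ) : Matrix (Fin n) (Fin n) (F ℓ n) :=
  fun i j => FreeAlgebra.ι K (Gen.d a i j)

/-- `R` over the free algebra. -/
def Rf : Matrix (Idx n) (Idx n) (F ℓ n) := ext n (F ℓ n) (Rm n)
/-- `R₂₁` over the free algebra. -/
def R21f : Matrix (Idx n) (Idx n) (F ℓ n) := ext n (F ℓ n) (Rm21 n)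
/-- `R⁻¹` over the free algebra. -/
def Rif : Matrix (Idx n) (Idx n) (F ℓ n) := ext n (F ℓ n) (Rm n)⁻¹
/-- `R₂₁⁻¹` over the free algebra. -/
def R21if : Matrix (Idx n) (Idx n) (F ℓ n) := ext n (F ℓ n) (Rm21 n)⁻¹
/-- `Ω` over the free algebra. -/
def Omf : Matrix (Idx n) (Idx n) (F ℓ n) := Om n (F ℓ n)

/-- `M₁` over the free algebra. -/
def o1 (M : Matrix (Fin n) (Fin n) (F ℓ n)) : Matrix (Idx n) (Idx n) (F ℓ n) :=
  m1 n (F ℓ n) M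
/-- `M₂` over the free algebra. -/
def o2 (M : Matrix (Fin n) (Fin n) (F ℓ n)) : Matrix (Idx n) (Idx n) (F ℓ n) :=
  m2 n (F ℓ n) M

/-- The defining relations of the algebra `D_ℓ` of quantum differential operators on the
framed cyclic quiver with `ℓ ≥ 2` vertices (including the replacement relations for
`ℓ = 2`). -/
inductive Rel (ℓ n : ℕ) : F ℓ n → F ℓ n → Prop
  | xaa (a : ZMod ℓ) (p r : Idx n) :
      Rel ℓ n ((R21f ℓ n * o1 ℓ n (XF ℓ n a) * o2 ℓ n (XF ℓ n a)) p r)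
              ((o2 ℓ n (XF ℓ n a) * o1 ℓ n (XF ℓ n a) * Rf ℓ n) p r)
  | daa (a : ZMod ℓ) (p r : Idx n) :
      Rel ℓ n ((R21f ℓ n * o1 ℓ n (DF ℓ n a) * o2 ℓ n (DF ℓ n a)) p r)
              ((o2 ℓ n (DF ℓ n a) * o1 ℓ n (DF ℓ n a) * Rf ℓ n) p r)
  | dxa (a : ZMod ℓ) (p r : Idx n) :
      Rel ℓ n ((o2 ℓ n (DF ℓ n a) * Rif ℓ n * o1 ℓ n (XF ℓ n a)) p r)
              ((o1 ℓ n (XF ℓ n a) * Rf ℓ n * o2 ℓ n (DF ℓ n a) + (qq - qq⁻¹) • Omf ℓ n) p r)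
  | xxadj (h : 3 ≤ ℓ) (a : ZMod ℓ) (p r : Idx n) :
      Rel ℓ n ((o1 ℓ n (XF ℓ n a) * o2 ℓ n (XF ℓ n (a - 1))) p r)
              ((o2 ℓ n (XF ℓ n (a - 1)) * R21f ℓ n * o1 ℓ n (XF ℓ n a)) p r)
  | xxcom (a b : ZMod ℓ) (h : b ≠ a ∧ b ≠ a + 1 ∧ b ≠ a - 1) (p r : Idx n) :
      Rel ℓ n ((o1 ℓ n (XF ℓ n a) * o2 ℓ n (XF ℓ n b)) p r)
              ((o2 ℓ n (XF ℓ n b) * o1 ℓ n (XF ℓ n a)) p r)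
  | ddadj (h : 3 ≤ ℓ) (a : ZMod ℓ) (p r : Idx n) :
      Rel ℓ n ((o1 ℓ n (DF ℓ n a) * o2 ℓ n (DF ℓ n (a + 1))) p r)
              ((o2 ℓ n (DF ℓ n (a + 1)) * Rif ℓ n * o1 ℓ n (DF ℓ n a)) p r)
  | ddcom (a b : ZMod ℓ) (h : b ≠ a ∧ b ≠ a + 1 ∧ b ≠ a - 1) (p r : Idx n) :
      Rel ℓ n ((o1 ℓ n (DF ℓ n a) * o2 ℓ n (DF ℓ n b)) p r)
              ((o2 ℓ n (DF ℓ n b) * o1 ℓ n (DF ℓ n a)) p r)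
  | dxadj1 (h : 3 ≤ ℓ) (a : ZMod ℓ) (p r : Idx n) :
      Rel ℓ n ((o1 ℓ n (DF ℓ n a) * o2 ℓ n (XF ℓ n (a + 1))) p r)
              ((Rf ℓ n * o2 ℓ n (XF ℓ n (a + 1)) * o1 ℓ n (DF ℓ n a)) p r)
  | dxadj2 (h : 3 ≤ ℓ) (a : ZMod ℓ) (p r : Idx n) :
      Rel ℓ n ((o1 ℓ n (DF ℓ n a) * o2 ℓ n (XF ℓ n (a - 1))) p r)
              ((o2 ℓ n (XF ℓ n (a - 1)) * o1 ℓ n (DF ℓ n a) * R21if ℓ n) p r)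
  | dxcom (a b : ZMod ℓ) (h : b ≠ a ∧ b ≠ a + 1 ∧ b ≠ a - 1) (p r : Idx n) :
      Rel ℓ n ((o1 ℓ n (DF ℓ n a) * o2 ℓ n (XF ℓ n b)) p r)
              ((o2 ℓ n (XF ℓ n b) * o1 ℓ n (DF ℓ n a)) p r)
  | xxadj2 (h : ℓ = 2) (p r : Idx n) :
      Rel ℓ n ((o1 ℓ n (XF ℓ n (1 + 1)) * Rf ℓ n * o2 ℓ n (XF ℓ n 1)) p r)
              ((o2 ℓ n (XF ℓ n 1) * R21f ℓ n * o1 ℓ n (XF ℓ n (1 + 1))) p r)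
  | ddadj2 (h : ℓ = 2) (p r : Idx n) :
      Rel ℓ n ((o1 ℓ n (DF ℓ n 1) * R21if ℓ n * o2 ℓ n (DF ℓ n (1 + 1))) p r)
              ((o2 ℓ n (DF ℓ n (1 + 1)) * Rif ℓ n * o1 ℓ n (DF ℓ n 1)) p r)
  | dxadj2' (h : ℓ = 2) (a : ZMod ℓ) (p r : Idx n) :
      Rel ℓ n ((o1 ℓ n (DF ℓ n a) * o2 ℓ n (XF ℓ n (a + 1))) p r)
              ((R21if ℓ n * o2 ℓ n (XF ℓ n (a + 1)) * o1 ℓ n (DF ℓ n a) * R21if ℓ n) p r)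

/-- The algebra `D_ℓ` of quantum differential operators on the framed cyclic quiver. -/
abbrev Dl (ℓ n : ℕ) := RingQuot (Rel ℓ n)

/-- The matrix `X^{(a)}` over `D_ℓ`. -/
def XM (a : ZMod ℓ) : Matrix (Fin n) (Fin n) (Dl ℓ n) :=
  fun i j => RingQuot.mkAlgHom K (Rel ℓ n) (XF ℓ n a i j)

/-- The matrix `D^{(a)}` over `D_ℓ`. -/
def DM (a : ZMod ℓ) : Matrix (Fin n) (Fin n) (Dl ℓ n) :=
  fun i j => RingQuot.mkAlgHom K (Rel ℓ n) (DF ℓ n a i j)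

/-- `R` over `D_ℓ`. -/
def Ra : Matrix (Idx n) (Idx n) (Dl ℓ n) := ext n (Dl ℓ n) (Rm n)
/-- `R₂₁` over `D_ℓ`. -/
def R21a : Matrix (Idx n) (Idx n) (Dl ℓ n) := ext n (Dl ℓ n) (Rm21 n)
/-- `R⁻¹` over `D_ℓ`. -/
def Ria : Matrix (Idx n) (Idx n) (Dl ℓ n) := ext n (Dl ℓ n) (Rm n)⁻¹
/-- `R₂₁⁻¹` over `D_ℓ`. -/
def R21ia : Matrix (Idx n) (Idx n) (Dl ℓ n) := ext n (Dl ℓ n) (Rm21 n)⁻¹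

/-- `M₁` over `D_ℓ`. -/
def q1 (M : Matrix (Fin n) (Fin n) (Dl ℓ n)) : Matrix (Idx n) (Idx n) (Dl ℓ n) :=
  m1 n (Dl ℓ n) M
/-- `M₂` over `D_ℓ`. -/
def q2 (M : Matrix (Fin n) (Fin n) (Dl ℓ n)) : Matrix (Idx n) (Idx n) (Dl ℓ n) :=
  m2 n (Dl ℓ n) M

/-- `X^∘ := X^{(1)} X^{(2)} ⋯ X^{(ℓ)}`. -/
def Xcirc : Matrix (Fin n) (Fin n) (Dl ℓ n) :=
  ((List.range ℓ).map fun k => XM ℓ n ((k : ZMod ℓ) + 1)).prod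

/-- `^LỸ^{(a)} := I + X^{(a)} D^{(a)}`. -/
def LY (a : ZMod ℓ) : Matrix (Fin n) (Fin n) (Dl ℓ n) := 1 + XM ℓ n a * DM ℓ n a

/-- `^RY^{(a)} := I + D^{(a)} X^{(a)}`. -/
def RYa (a : ZMod ℓ) : Matrix (Fin n) (Fin n) (Dl ℓ n) := 1 + DM ℓ n a * XM ℓ n a

end Dell

open Matrix

namespace Rmatrix

section Embedding

variable {A T I J : Type*} [Ring A] [Fintype T] [DecidableEq T] [Fintype I] [DecidableEq I]
  [Fintype J] [DecidableEq J]

/-- The embedding `M ↦ M ⊗ 1` of matrices indexed by `I` into matrices indexed by `T ≃ I × J`. -/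
def emb (e : T ≃ I × J) : Matrix I I A →+* Matrix T T A where
  toFun M := (blockDiagonal fun _ => M).submatrix e e
  map_one' := by
    have h : (blockDiagonal fun _ : J => (1 : Matrix I I A)) = 1 := blockDiagonal_one
    rw [h, submatrix_one_equiv]
  map_mul' M N := by
    rw [blockDiagonal_mul (fun _ : J => M) (fun _ : J => N), submatrix_mul_equiv]
  map_zero' := by
    have h : (blockDiagonal fun _ : J => (0 : Matrix I I A)) = 0 := blockDiagonal_zero
    rw [h, submatrix_zero]; rfl
  map_add' M N := by
    have h := blockDiagonal_add (fun _ : J => M) (fun _ : J => N)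
    exact congrArg (fun B => B.submatrix e e) h

lemma emb_apply (e : T ≃ I × J) (M : Matrix I I A) (p r : T) :
    emb e M p r = if (e p).2 = (e r).2 then M (e p).1 (e r).1 else 0 := by
  change (blockDiagonal fun _ => M).submatrix e e p r = _
  simp [blockDiagonal_apply]

lemma emb_injective (e : T ≃ I × J) [Nonempty J] :
    Function.Injective (emb e : Matrix I I A →+* Matrix T T A) := by
  intro M N h
  obtain ⟨j⟩ := ‹Nonempty J›
  ext a b
  simpa [emb_apply] using congrFun (congrFun h (e.symm (a, j))) (e.symm (b, j))

/-- Matrices in complementary tensor factors commute as soon as one of them has scalar entries. -/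
lemma commute_emb_map_emb {k : Type*} [CommRing k] [Algebra k A] (e : T ≃ I × J)
    (M : Matrix I I k) (N : Matrix J J A) :
    Commute (emb e (M.map (algebraMap k A))) (emb (e.trans (Equiv.prodComm I J)) N) := by
  ext p r
  simp only [mul_apply, emb_apply]
  rw [← e.symm.sum_comp, ← e.symm.sum_comp, Fintype.sum_prod_type, Fintype.sum_prod_type]
  simp [ite_mul, mul_ite, Finset.sum_ite_eq, Algebra.commutes]

lemma map_emb {k : Type*} [CommRing k] [Algebra k A] (e : T ≃ I × J) (M : Matrix I I k) :
    (emb e M).map (algebraMap k A) = emb e (M.map (algebraMap k A)) := by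
  ext p r
  simp only [map_apply, emb_apply]
  split_ifs <;> simp

lemma two_term_mul_apply {N M : Matrix T T A} {c d : T → A} {s : T → T}
    (hN : ∀ p r, N p r = (if r = p then c p else 0) + if r = s p then d p else 0) (p r : T) :
    (N * M) p r = c p * M p r + d p * M (s p) r := by
  simp [mul_apply, hN, add_mul, Finset.sum_add_distrib, ite_mul]

end Embedding

section Scalar

variable (n : ℕ)

lemma qq_ne_zero : qq ≠ 0 := RatFunc.X_ne_zero

lemma qq_sub_inv_ne_zero : qq - qq⁻¹ ≠ 0 := by
  intro h
  have h1 : (qq : K) ^ 2 = 1 := by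
    have := qq_ne_zero
    field_simp at h
    linear_combination h
  have h2 : algebraMap (Polynomial ℂ) K (Polynomial.X ^ 2) = algebraMap (Polynomial ℂ) K 1 := by
    simpa [qq] using h1
  have h3 := RatFunc.algebraMap_injective ℂ h2
  have h4 := congrArg Polynomial.natDegree h3
  simp at h4

lemma Rm_apply (p r : Idx n) :
    Rm n p r = (if r = p then (if p.1 = p.2 then qq else 1) else 0) +
      if r = p.swap then (if p.1 < p.2 then qq - qq⁻¹ else 0) else 0 := by
  obtain ⟨a, b⟩ := p
  obtain ⟨c, d⟩ := r
  simp only [Rm, Prod.mk.injEq, Prod.swap_prod_mk]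
  congr 1
  · by_cases h : c = a ∧ d = b
    · obtain ⟨rfl, rfl⟩ := h
      by_cases h' : c = d <;> simp [h']
    · have h' : ¬(a = c ∧ b = d) := fun ⟨h1, h2⟩ => h ⟨h1.symm, h2.symm⟩
      have h1 : ¬(a = c ∧ b = d ∧ a = b) := fun ⟨h1, h2, _⟩ => h' ⟨h1, h2⟩
      have h2 : ¬(a = c ∧ b = d ∧ a ≠ b) := fun ⟨h1, h2, _⟩ => h' ⟨h1, h2⟩
      simp [h, h1, h2]
  · by_cases h : c = b ∧ d = a
    · obtain ⟨rfl, rfl⟩ := h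
      simp
    · have h1 : ¬(a = d ∧ b = c ∧ a < b) := fun ⟨h1, h2, _⟩ => h ⟨h2.symm, h1.symm⟩
      simp [h, h1]

/-- The flip `P = Σ E_ij ⊗ E_ji` with scalar entries. -/
abbrev flipMatrix : Matrix (Idx n) (Idx n) K := Om n K

lemma Rm_mul_Rm21_sub : Rm n * (Rm21 n - (qq - qq⁻¹) • flipMatrix n) = 1 := by
  have hq := qq_ne_zero
  ext p r
  rw [two_term_mul_apply (Rm_apply n)]
  obtain ⟨a, b⟩ := p
  have hO : ∀ s : Idx n, flipMatrix n s r = if r = s.swap then 1 else 0 := by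
    intro s
    simp only [Om, Prod.ext_iff, Prod.fst_swap, Prod.snd_swap]
    congr 1
    exact propext ⟨fun h => ⟨h.2.symm, h.1.symm⟩, fun h => ⟨h.2.symm, h.1.symm⟩⟩
  simp only [Matrix.sub_apply, Matrix.smul_apply, hO, smul_eq_mul, Rm21, Rm_apply, one_apply]
  obtain ⟨c, d⟩ := r
  simp only [Prod.mk.injEq, Prod.swap_prod_mk]
  rcases lt_trichotomy a b with h | rfl | h
  · have h1 := h.ne
    have h2 := h.not_gt
    by_cases h3 : c = a <;> by_cases h4 : d = b <;> by_cases h5 : c = b <;> by_cases h6 : d = a <;>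
      simp_all [eq_comm]
  · by_cases h3 : c = a <;> by_cases h4 : d = a <;>  simp_all [eq_comm]
  · have h1 := h.ne'
    have h2 := h.not_gt
    by_cases h3 : c = a <;> by_cases h4 : d = b <;> by_cases h5 : c = b <;> by_cases h6 : d = a <;>
      simp_all [eq_comm]

lemma Rm21_mul_Rm_sub : Rm21 n * (Rm n - (qq - qq⁻¹) • flipMatrix n) = 1 := by
  have h := congrArg (fun M => M.submatrix (Equiv.prodComm _ _) (Equiv.prodComm _ _))
    (Rm_mul_Rm21_sub n)
  simp only [submatrix_one_equiv, ← submatrix_mul_equiv _ _ _ (Equiv.prodComm _ _)] at h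
  rw [← h]
  congr 1
  ext p r
  simp [Rm21, Om, and_comm]

lemma Rm_inv : (Rm n)⁻¹ = Rm21 n - (qq - qq⁻¹) • flipMatrix n :=
  inv_eq_right_inv (Rm_mul_Rm21_sub n)

lemma Rm21_inv : (Rm21 n)⁻¹ = Rm n - (qq - qq⁻¹) • flipMatrix n :=
  inv_eq_right_inv (Rm21_mul_Rm_sub n)

lemma Rm_mul_inv : Rm n * (Rm n)⁻¹ = 1 := by rw [Rm_inv, Rm_mul_Rm21_sub]

lemma Rm_inv_mul : (Rm n)⁻¹ * Rm n = 1 := mul_eq_one_comm.mp (Rm_mul_inv n)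

lemma Rm21_mul_inv : Rm21 n * (Rm21 n)⁻¹ = 1 := by rw [Rm21_inv, Rm21_mul_Rm_sub]

lemma Rm21_inv_mul : (Rm21 n)⁻¹ * Rm21 n = 1 := mul_eq_one_comm.mp (Rm21_mul_inv n)

/-- Index type for `M_n ⊗ M_n ⊗ M_n`. -/
abbrev Idx3 (n : ℕ) := Fin n × Fin n × Fin n

/-- Singles out the tensor factors `1, 2` among three. -/
def e12 : Idx3 n ≃ Idx n × Fin n where
  toFun p := ((p.1, p.2.1), p.2.2)
  invFun s := (s.1.1, s.1.2, s.2)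
  left_inv _ := rfl
  right_inv _ := rfl

/-- Singles out the tensor factors `1, 3` among three. -/
def e13 : Idx3 n ≃ Idx n × Fin n where
  toFun p := ((p.1, p.2.2), p.2.1)
  invFun s := (s.1.1, s.2, s.1.2)
  left_inv _ := rfl
  right_inv _ := rfl

/-- Singles out the tensor factors `2, 3` among three. -/
def e23 : Idx3 n ≃ Idx n × Fin n where
  toFun p := ((p.2.1, p.2.2), p.1)
  invFun s := (s.2, s.1.1, s.1.2)
  left_inv _ := rfl
  right_inv _ := rfl

lemma emb_Rm_mul_apply (e : Idx3 n ≃ Idx n × Fin n) (M : Matrix (Idx3 n) (Idx3 n) K)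
    (p r : Idx3 n) :
    (emb e (Rm n) * M) p r = (if (e p).1.1 = (e p).1.2 then qq else 1) * M p r +
      (if (e p).1.1 < (e p).1.2 then qq - qq⁻¹ else 0) *
        M (e.symm ((e p).1.swap, (e p).2)) r := by
  refine two_term_mul_apply (c := fun p => if (e p).1.1 = (e p).1.2 then qq else 1)
    (d := fun p => if (e p).1.1 < (e p).1.2 then qq - qq⁻¹ else 0)
    (s := fun p => e.symm ((e p).1.swap, (e p).2)) (fun p r => ?_) p r
  obtain ⟨s, rfl⟩ := e.symm.surjective p
  obtain ⟨t, rfl⟩ := e.symm.surjective r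
  simp only [emb_apply, Equiv.apply_symm_apply, Rm_apply, Equiv.apply_eq_iff_eq]
  obtain ⟨s1, s2⟩ := s
  obtain ⟨t1, t2⟩ := t
  by_cases h : s2 = t2
  · simp [h]
  · simp [h, Ne.symm h]

theorem yang_baxter :
    emb (e12 n) (Rm n) * (emb (e13 n) (Rm n) * emb (e23 n) (Rm n)) =
      emb (e23 n) (Rm n) * (emb (e13 n) (Rm n) * emb (e12 n) (Rm n)) := by
  rw [← mul_one (emb (e12 n) (Rm n)), ← mul_one (emb (e23 n) (Rm n))]
  ext ⟨a, b, c⟩ r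
  simp only [mul_assoc, one_mul, emb_Rm_mul_apply]
  generalize (1 : Matrix (Idx3 n) (Idx3 n) K) = N
  change Idx3 n → Idx3 n → K at N
  have e12a (x y z : Fin n) : e12 n (x, y, z) = ((x, y), z) := rfl
  have e13a (x y z : Fin n) : e13 n (x, y, z) = ((x, z), y) := rfl
  have e23a (x y z : Fin n) : e23 n (x, y, z) = ((y, z), x) := rfl
  have e12s (x y z : Fin n) : (e12 n).symm ((x, y), z) = (x, y, z) := rfl
  have e13s (x y z : Fin n) : (e13 n).symm ((x, y), z) = (x, z, y) := rfl
  have e23s (x y z : Fin n) : (e23 n).symm ((x, y), z) = (z, x, y) := rfl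
  simp only [e12a, e13a, e23a, e12s, e13s, e23s, Prod.swap_prod_mk]
  clear e12a e13a e23a e12s e13s e23s
  have hq := qq_ne_zero
  rcases lt_trichotomy a b with h1 | h1 | h1 <;> rcases lt_trichotomy b c with h2 | h2 | h2 <;>
    rcases lt_trichotomy a c with h3 | h3 | h3 <;>
    first
    | (exfalso; order)
    | (subst_vars
       simp only [*, LT.lt.ne, LT.lt.ne', LT.lt.not_gt, lt_irrefl, if_true, if_false]
       try field_simp
       try ring)

theorem yang_baxter_321 :
    emb (e23 n) (Rm21 n) * (emb (e13 n) (Rm21 n) * emb (e12 n) (Rm21 n)) =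
      emb (e12 n) (Rm21 n) * (emb (e13 n) (Rm21 n) * emb (e23 n) (Rm21 n)) := by
  let σ : Idx3 n ≃ Idx3 n :=
    ⟨fun p => (p.2.2, p.2.1, p.1), fun p => (p.2.2, p.2.1, p.1), fun _ => rfl, fun _ => rfl⟩
  have h := congrArg (fun M => M.submatrix σ σ) (yang_baxter n)
  simp only [← submatrix_mul_equiv _ _ _ σ] at h
  exact h

theorem yang_baxter_231 :
    emb (e23 n) (Rm n) * (emb (e12 n) (Rm21 n) * emb (e13 n) (Rm21 n)) =
      emb (e13 n) (Rm21 n) * (emb (e12 n) (Rm21 n) * emb (e23 n) (Rm n)) := by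
  let σ : Idx3 n ≃ Idx3 n :=
    ⟨fun p => (p.2.1, p.2.2, p.1), fun p => (p.2.2, p.1, p.2.1), fun _ => rfl, fun _ => rfl⟩
  have h := congrArg (fun M => M.submatrix σ σ) (yang_baxter n)
  simp only [← submatrix_mul_equiv _ _ _ σ] at h
  exact h

end Scalar

section RingIdentities

variable {B : Type*} [Ring B]

lemma one_add_mul_exchange_left {x₁ x₂ d₁ r r' s' t : B}
    (hdx : d₁ * s' * x₂ = x₂ * r' * d₁ + t) (hxx : r * x₂ * x₁ = x₁ * x₂ * r')
    (hs : s' = r - t) (ht : x₁ * t = t * x₂) :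
    (1 + x₁ * d₁) * s' * x₂ = r * x₂ * (1 + x₁ * d₁) := by
  linear_combination (norm := noncomm_ring) x₁ * hdx - hxx * d₁ + hs * x₂ + ht

lemma one_add_mul_exchange_right {x₁ d₁ d₂ r r' s t : B}
    (hdx : d₂ * s * x₁ = x₁ * r * d₂ + t) (hdd : r * d₂ * d₁ = d₁ * d₂ * r')
    (hs : s = r' - t) (ht : t * d₁ = d₂ * t) :
    (1 + x₁ * d₁) * d₂ * r' = d₂ * s * (1 + x₁ * d₁) := by
  linear_combination (norm := noncomm_ring) -(x₁ * hdd) - hdx * d₁ - d₂ * hs - ht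

lemma reflection_of_exchange {y₁ x₂ d₂ r r' s s' : B}
    (hyx : y₁ * s' * x₂ = r * x₂ * y₁) (hyd : y₁ * d₂ * r' = d₂ * s * y₁)
    (hsr : s * r = 1) (hrs : r' * s' = 1) :
    s * y₁ * s' * (1 + x₂ * d₂) = (1 + x₂ * d₂) * s * y₁ * s' := by
  linear_combination (norm := noncomm_ring)
    s * hyx * d₂ + hsr * x₂ * y₁ * d₂ - x₂ * y₁ * d₂ * hrs + x₂ * hyd * s'

/-- Incompatibility of the relations for `ℓ = 2`, in abstract form. -/
lemma eq_zero_of_exchange {D X Z r₂₁ s₂₁ r₂₃ r₃₂ s₃₂ r₁₃ r₃₁ s₃₁ t u v : B}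
    (hdx : D * s₂₁ * X = X * r₂₁ * D + t) (hzx : Z * r₃₂ * X = X * r₂₃ * Z)
    (hdz : D * Z = s₃₁ * Z * D * s₃₁)
    (hD₂₃ : D * r₂₃ = r₂₃ * D) (hD₃₂ : D * r₃₂ = r₃₂ * D)
    (hZr : r₂₁ * Z = Z * r₂₁) (hZs : s₂₁ * Z = Z * s₂₁) (hX : s₃₁ * X = X * s₃₁)
    (hZt : t * Z = Z * t) (htr : t * r₂₃ = r₁₃ * t) (hts : t * s₃₁ = s₃₂ * t)
    (hrs : r₃₂ * s₃₂ = 1) (hr₂₁ : s₂₁ * r₂₁ = 1) (hr₂₁' : r₂₁ * s₂₁ = 1)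
    (hr₃₁ : s₃₁ * r₃₁ = 1) (hr₃₁' : r₃₁ * s₃₁ = 1)
    (hyb : r₃₂ * (r₃₁ * r₂₁) = r₂₁ * (r₃₁ * r₃₂)) (hyb' : r₂₃ * (r₂₁ * r₃₁) = r₃₁ * (r₂₁ * r₂₃))
    (hu : t * u = 1) (hv : v * (r₁₃ - s₃₁) = 1) : Z = 0 := by
  have yb₁ : s₃₁ * s₂₁ * r₃₂ = r₃₂ * s₂₁ * s₃₁ := by
    have h : s₃₁ * s₂₁ * (r₃₂ * (r₃₁ * r₂₁)) * s₂₁ * s₃₁ =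
        s₃₁ * s₂₁ * (r₂₁ * (r₃₁ * r₃₂)) * s₂₁ * s₃₁ := by rw [hyb]
    have h₁ : s₃₁ * s₂₁ * (r₃₂ * (r₃₁ * r₂₁)) * s₂₁ * s₃₁ =
        s₃₁ * s₂₁ * r₃₂ * (r₃₁ * (r₂₁ * s₂₁) * s₃₁) := by simp only [mul_assoc]
    have h₂ : s₃₁ * s₂₁ * (r₂₁ * (r₃₁ * r₃₂)) * s₂₁ * s₃₁ =
        s₃₁ * (s₂₁ * r₂₁) * r₃₁ * (r₃₂ * s₂₁ * s₃₁) := by simp only [mul_assoc]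
    rwa [h₁, h₂, hr₂₁, hr₂₁', mul_one, mul_one, hr₃₁, hr₃₁', mul_one, one_mul] at h
  have yb₂ : s₃₁ * r₂₃ * r₂₁ = r₂₁ * r₂₃ * s₃₁ := by
    have h : s₃₁ * (r₂₃ * (r₂₁ * r₃₁)) * s₃₁ = s₃₁ * (r₃₁ * (r₂₁ * r₂₃)) * s₃₁ := by rw [hyb']
    have h₁ : s₃₁ * (r₂₃ * (r₂₁ * r₃₁)) * s₃₁ = s₃₁ * r₂₃ * r₂₁ * (r₃₁ * s₃₁) := by
      simp only [mul_assoc]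
    have h₂ : s₃₁ * (r₃₁ * (r₂₁ * r₂₃)) * s₃₁ = s₃₁ * r₃₁ * (r₂₁ * r₂₃ * s₃₁) := by
      simp only [mul_assoc]
    rwa [h₁, h₂, hr₃₁, hr₃₁', mul_one, one_mul] at h
  have key₁ : D * s₂₁ * X * r₂₃ * Z = X * r₂₁ * r₂₃ * s₃₁ * Z * D * s₃₁ + r₁₃ * Z * t := by
    linear_combination (norm := noncomm_ring)
      hdx * r₂₃ * Z + X * r₂₁ * hD₂₃ * Z + X * r₂₁ * r₂₃ * hdz + htr * Z + r₁₃ * hZt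
  have key₂ : D * s₂₁ * X * r₂₃ * Z = s₃₁ * Z * r₃₂ * (D * s₂₁ * X) * s₃₁ := by
    linear_combination (norm := noncomm_ring)
      -(D * s₂₁ * hzx) + D * hZs * r₃₂ * X + hdz * s₂₁ * r₃₂ * X + s₃₁ * Z * D * yb₁ * X +
        s₃₁ * Z * hD₃₂ * s₂₁ * s₃₁ * X + s₃₁ * Z * r₃₂ * D * s₂₁ * hX
  have key₃ : s₃₁ * Z * r₃₂ * (D * s₂₁ * X) * s₃₁ =
      X * r₂₁ * r₂₃ * s₃₁ * Z * D * s₃₁ + s₃₁ * Z * t := by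
    linear_combination (norm := noncomm_ring)
      s₃₁ * Z * r₃₂ * hdx * s₃₁ + s₃₁ * hzx * r₂₁ * D * s₃₁ + hX * r₂₃ * Z * r₂₁ * D * s₃₁ -
        X * s₃₁ * r₂₃ * hZr * D * s₃₁ + X * yb₂ * Z * D * s₃₁ + s₃₁ * Z * r₃₂ * hts +
        s₃₁ * Z * hrs * t
  have h : (r₁₃ - s₃₁) * Z * t = 0 := by
    linear_combination (norm := noncomm_ring) -key₁ + key₂ + key₃
  calc Z = v * (r₁₃ - s₃₁) * Z * (t * u) := by rw [hu, hv, one_mul, mul_one]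
    _ = v * ((r₁₃ - s₃₁) * Z * t) * u := by simp only [mul_assoc]
    _ = 0 := by rw [h, mul_zero, zero_mul]

lemma one_add_mul_exchange_pred {x d z r' s' : B} (hdz : d * z = z * d * s')
    (hxz : x * z = z * r' * x) (hsr : s' * r' = 1) :
    (1 + x * d) * z * r' = z * r' * (1 + x * d) := by
  linear_combination (norm := noncomm_ring) x * hdz * r' + x * z * d * hsr + hxz * d

lemma exchange_mul {b₁ b₂ c₁ c₂ r r' : B} (hb : r' * b₁ * b₂ = b₂ * b₁ * r)
    (hc : r' * c₁ * c₂ = c₂ * c₁ * r) (hcb : c₁ * b₂ = b₂ * r' * c₁)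
    (hbc : b₁ * r * c₂ = c₂ * b₁) :
    r' * (b₁ * c₁) * (b₂ * c₂) = b₂ * c₂ * (b₁ * c₁) * r := by
  linear_combination (norm := noncomm_ring)
    r' * b₁ * hcb * c₂ + hb * r' * c₁ * c₂ + b₂ * b₁ * r * hc + b₂ * hbc * c₁ * r

lemma reflection_mul {b₁ b₂ c₁ c₂ r r' : B} (hb : r' * b₁ * b₂ = b₂ * b₁ * r)
    (hc : r' * c₁ * c₂ = c₂ * c₁ * r) (hcb : c₁ * r * b₂ = b₂ * r' * c₁)
    (hbc : b₁ * r * c₂ = c₂ * r' * b₁) :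
    r' * (b₁ * c₁) * r * (b₂ * c₂) = b₂ * c₂ * r' * (b₁ * c₁) * r := by
  linear_combination (norm := noncomm_ring)
    r' * b₁ * hcb * c₂ + hb * r' * c₁ * c₂ + b₂ * b₁ * r * hc + b₂ * hbc * c₁ * r

lemma exchange_mul_mul {y x w z r r' s' : B} (hx : y * s' * x = r * x * y) (hw : Commute y w)
    (hz : y * z * r' = z * r' * y) :
    y * s' * (x * w * z) * r' = r * (x * w * z) * r' * y := by
  linear_combination (norm := noncomm_ring)
    hx * w * z * r' + r * x * hw.eq * z * r' + r * x * w * hz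

end RingIdentities

section Leg

variable {n : ℕ} {A : Type} [Ring A]

lemma m1_eq_emb (M : Matrix (Fin n) (Fin n) A) : m1 n A M = emb (Equiv.refl (Idx n)) M := by
  ext p r; rw [emb_apply]; rfl

lemma m2_eq_emb (M : Matrix (Fin n) (Fin n) A) : m2 n A M = emb (Equiv.prodComm _ _) M := by
  ext p r; rw [emb_apply]; rfl

variable [Algebra K A]

lemma ext_eq_mapMatrix (M : Matrix (Idx n) (Idx n) K) :
    ext n A M = (algebraMap K A).mapMatrix M := rfl

lemma ext_mul (M N : Matrix (Idx n) (Idx n) K) : ext n A (M * N) = ext n A M * ext n A N := by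
  simp only [ext_eq_mapMatrix, map_mul]

lemma ext_sub (M N : Matrix (Idx n) (Idx n) K) : ext n A (M - N) = ext n A M - ext n A N := by
  simp only [ext_eq_mapMatrix, map_sub]

lemma ext_one : ext n A 1 = 1 := by simp only [ext_eq_mapMatrix, map_one]

/-- Exchange of the two tensor factors. -/
def swapLegs : Matrix (Idx n) (Idx n) A ≃ₐ[K] Matrix (Idx n) (Idx n) A :=
  reindexAlgEquiv K A (Equiv.prodComm _ _)

lemma swapLegs_ext (M : Matrix (Idx n) (Idx n) K) :
    swapLegs (ext n A M) = ext n A (M.submatrix (Equiv.prodComm _ _) (Equiv.prodComm _ _)) := rfl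

lemma swapLegs_Rm_inv : swapLegs (ext n A (Rm n)⁻¹) = ext n A (Rm21 n)⁻¹ := by
  rw [swapLegs_ext, ← inv_submatrix_equiv]; rfl

/-- `(q - q⁻¹) Ω`. -/
def scaledOm (n : ℕ) (A : Type) [Ring A] [Algebra K A] : Matrix (Idx n) (Idx n) A :=
  ext n A ((qq - qq⁻¹) • flipMatrix n)

lemma smul_Om : (qq - qq⁻¹) • Om n A = scaledOm n A := by
  ext p r
  by_cases h : p.1 = r.2 ∧ p.2 = r.1 <;> simp [scaledOm, ext, Om, h, Algebra.algebraMap_eq_smul_one]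

lemma swapLegs_scaledOm : swapLegs (scaledOm n A) = scaledOm n A := by
  rw [scaledOm, swapLegs_ext]
  congr 1
  ext p r
  simp [Om, and_comm]

lemma scaledOm_apply (p r : Idx n) :
    scaledOm n A p r = if p = r.swap then algebraMap K A (qq - qq⁻¹) else 0 := by
  by_cases h : p = r.swap
  · subst h; simp [scaledOm, ext, Om]
  · have h' : ¬(p.1 = r.2 ∧ p.2 = r.1) := fun h' => h (Prod.ext h'.1 h'.2)
    simp [scaledOm, ext, Om, h, h']

lemma scaledOm_mul_apply (M : Matrix (Idx n) (Idx n) A) (p r : Idx n) :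
    (scaledOm n A * M) p r = algebraMap K A (qq - qq⁻¹) * M p.swap r := by
  rw [mul_apply, Finset.sum_eq_single p.swap]
  · simp [scaledOm_apply]
  · intro s _ hs
    have : p ≠ s.swap := fun h => hs (by simp [h])
    simp [scaledOm_apply, this]
  · simp

lemma mul_scaledOm_apply (M : Matrix (Idx n) (Idx n) A) (p r : Idx n) :
    (M * scaledOm n A) p r = algebraMap K A (qq - qq⁻¹) * M p r.swap := by
  rw [mul_apply, Finset.sum_eq_single r.swap]
  · rw [scaledOm_apply, if_pos (by simp), Algebra.commutes]
  · intro s _ hs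
    simp [scaledOm_apply, hs]
  · simp

lemma mul_scaledOm (M : Matrix (Idx n) (Idx n) A) :
    M * scaledOm n A = scaledOm n A * swapLegs M := by
  ext p r
  rw [mul_scaledOm_apply, scaledOm_mul_apply]
  rfl

/-- `(q - q⁻¹)⁻¹ Ω`. -/
def invScaledOm (n : ℕ) (A : Type) [Ring A] [Algebra K A] : Matrix (Idx n) (Idx n) A :=
  ext n A ((qq - qq⁻¹)⁻¹ • flipMatrix n)

lemma flipMatrix_mul_self : flipMatrix n * flipMatrix n = 1 := by
  ext p r
  rw [mul_apply, Finset.sum_eq_single p.swap]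
  · simp [Om, one_apply, Prod.ext_iff, and_comm]
  · intro s _ hs
    have : ¬(p.1 = s.2 ∧ p.2 = s.1) := fun h => hs (Prod.ext h.2.symm h.1.symm)
    simp [Om, this]
  · simp

lemma scaledOm_mul_inv : scaledOm n A * invScaledOm n A = 1 := by
  rw [scaledOm, invScaledOm, ← ext_mul, smul_mul_smul_comm, mul_inv_cancel₀ qq_sub_inv_ne_zero,
    one_smul, flipMatrix_mul_self, ext_one]

lemma inv_mul_scaledOm : invScaledOm n A * scaledOm n A = 1 := by
  rw [scaledOm, invScaledOm, ← ext_mul, smul_mul_smul_comm, inv_mul_cancel₀ qq_sub_inv_ne_zero,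
    one_smul, flipMatrix_mul_self, ext_one]

lemma ext_Rm_inv : ext n A (Rm n)⁻¹ = ext n A (Rm21 n) - scaledOm n A := by
  rw [Rm_inv, ext_sub, scaledOm]

lemma ext_Rm21_inv : ext n A (Rm21 n)⁻¹ = ext n A (Rm n) - scaledOm n A := by
  rw [Rm21_inv, ext_sub, scaledOm]

end Leg

end Rmatrix

namespace Dell

open Rmatrix

variable {ℓ n : ℕ}

lemma mapMatrix_eq_of_rel {M N : Matrix (Idx n) (Idx n) (F ℓ n)}
    (h : ∀ p r, Rel ℓ n (M p r) (N p r)) :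
    (RingQuot.mkAlgHom K (Rel ℓ n)).mapMatrix M = (RingQuot.mkAlgHom K (Rel ℓ n)).mapMatrix N := by
  ext p r
  exact RingQuot.mkAlgHom_rel K (h p r)

lemma mapMatrix_ext (M : Matrix (Idx n) (Idx n) K) :
    (RingQuot.mkAlgHom K (Rel ℓ n)).mapMatrix (ext n (F ℓ n) M) = ext n (Dl ℓ n) M := by
  ext p r
  exact (RingQuot.mkAlgHom K (Rel ℓ n)).commutes (M p r)

lemma mapMatrix_o1 (M : Matrix (Fin n) (Fin n) (F ℓ n)) :
    (RingQuot.mkAlgHom K (Rel ℓ n)).mapMatrix (o1 ℓ n M) =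
      q1 ℓ n ((RingQuot.mkAlgHom K (Rel ℓ n)).mapMatrix M) := by
  ext p r
  simp only [o1, q1, m1, AlgHom.mapMatrix_apply, map_apply]
  split_ifs <;> simp

lemma mapMatrix_o2 (M : Matrix (Fin n) (Fin n) (F ℓ n)) :
    (RingQuot.mkAlgHom K (Rel ℓ n)).mapMatrix (o2 ℓ n M) =
      q2 ℓ n ((RingQuot.mkAlgHom K (Rel ℓ n)).mapMatrix M) := by
  ext p r
  simp only [o2, q2, m2, AlgHom.mapMatrix_apply, map_apply]
  split_ifs <;> simp

lemma mapMatrix_XF (a : ZMod ℓ) :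
    (RingQuot.mkAlgHom K (Rel ℓ n)).mapMatrix (XF ℓ n a) = XM ℓ n a := rfl

lemma mapMatrix_DF (a : ZMod ℓ) :
    (RingQuot.mkAlgHom K (Rel ℓ n)).mapMatrix (DF ℓ n a) = DM ℓ n a := rfl

lemma mapMatrix_Rf :
    (RingQuot.mkAlgHom K (Rel ℓ n)).mapMatrix (Rf ℓ n) = Ra ℓ n := mapMatrix_ext _

lemma mapMatrix_R21f :
    (RingQuot.mkAlgHom K (Rel ℓ n)).mapMatrix (R21f ℓ n) = R21a ℓ n := mapMatrix_ext _

lemma mapMatrix_Rif :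
    (RingQuot.mkAlgHom K (Rel ℓ n)).mapMatrix (Rif ℓ n) = Ria ℓ n := mapMatrix_ext _

lemma mapMatrix_R21if :
    (RingQuot.mkAlgHom K (Rel ℓ n)).mapMatrix (R21if ℓ n) = R21ia ℓ n := mapMatrix_ext _

lemma mapMatrix_Omf :
    (RingQuot.mkAlgHom K (Rel ℓ n)).mapMatrix ((qq - qq⁻¹) • Omf ℓ n) = scaledOm n (Dl ℓ n) := by
  rw [Omf, smul_Om, scaledOm, mapMatrix_ext, scaledOm]

lemma XX_same (a : ZMod ℓ) : R21a ℓ n * q1 ℓ n (XM ℓ n a) * q2 ℓ n (XM ℓ n a) =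
    q2 ℓ n (XM ℓ n a) * q1 ℓ n (XM ℓ n a) * Ra ℓ n := by
  simpa only [map_mul, mapMatrix_o1, mapMatrix_o2, mapMatrix_XF, mapMatrix_Rf, mapMatrix_R21f]
    using mapMatrix_eq_of_rel (Rel.xaa (ℓ := ℓ) (n := n) a)

lemma DD_same (a : ZMod ℓ) : R21a ℓ n * q1 ℓ n (DM ℓ n a) * q2 ℓ n (DM ℓ n a) =
    q2 ℓ n (DM ℓ n a) * q1 ℓ n (DM ℓ n a) * Ra ℓ n := by
  simpa only [map_mul, mapMatrix_o1, mapMatrix_o2, mapMatrix_DF, mapMatrix_Rf, mapMatrix_R21f]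
    using mapMatrix_eq_of_rel (Rel.daa (ℓ := ℓ) (n := n) a)

lemma DX_same (a : ZMod ℓ) : q2 ℓ n (DM ℓ n a) * Ria ℓ n * q1 ℓ n (XM ℓ n a) =
    q1 ℓ n (XM ℓ n a) * Ra ℓ n * q2 ℓ n (DM ℓ n a) + scaledOm n (Dl ℓ n) := by
  simpa only [map_mul, map_add, mapMatrix_o1, mapMatrix_o2, mapMatrix_DF, mapMatrix_XF,
    mapMatrix_Rf, mapMatrix_Rif, mapMatrix_Omf]
    using mapMatrix_eq_of_rel (Rel.dxa (ℓ := ℓ) (n := n) a)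

lemma XX_pred (h : 3 ≤ ℓ) (a : ZMod ℓ) : q1 ℓ n (XM ℓ n a) * q2 ℓ n (XM ℓ n (a - 1)) =
    q2 ℓ n (XM ℓ n (a - 1)) * R21a ℓ n * q1 ℓ n (XM ℓ n a) := by
  simpa only [map_mul, mapMatrix_o1, mapMatrix_o2, mapMatrix_XF, mapMatrix_R21f]
    using mapMatrix_eq_of_rel (Rel.xxadj (n := n) h a)

lemma XX_far {a b : ZMod ℓ} (h : b ≠ a ∧ b ≠ a + 1 ∧ b ≠ a - 1) :
    Commute (q1 ℓ n (XM ℓ n a)) (q2 ℓ n (XM ℓ n b)) := by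
  rw [commute_iff_eq]
  simpa only [map_mul, mapMatrix_o1, mapMatrix_o2, mapMatrix_XF]
    using mapMatrix_eq_of_rel (Rel.xxcom (n := n) a b h)

lemma DX_succ (h : 3 ≤ ℓ) (a : ZMod ℓ) : q1 ℓ n (DM ℓ n a) * q2 ℓ n (XM ℓ n (a + 1)) =
    Ra ℓ n * q2 ℓ n (XM ℓ n (a + 1)) * q1 ℓ n (DM ℓ n a) := by
  simpa only [map_mul, mapMatrix_o1, mapMatrix_o2, mapMatrix_XF, mapMatrix_DF, mapMatrix_Rf]
    using mapMatrix_eq_of_rel (Rel.dxadj1 (n := n) h a)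

lemma DX_pred (h : 3 ≤ ℓ) (a : ZMod ℓ) : q1 ℓ n (DM ℓ n a) * q2 ℓ n (XM ℓ n (a - 1)) =
    q2 ℓ n (XM ℓ n (a - 1)) * q1 ℓ n (DM ℓ n a) * R21ia ℓ n := by
  simpa only [map_mul, mapMatrix_o1, mapMatrix_o2, mapMatrix_XF, mapMatrix_DF, mapMatrix_R21if]
    using mapMatrix_eq_of_rel (Rel.dxadj2 (n := n) h a)

lemma DX_far {a b : ZMod ℓ} (h : b ≠ a ∧ b ≠ a + 1 ∧ b ≠ a - 1) :
    Commute (q1 ℓ n (DM ℓ n a)) (q2 ℓ n (XM ℓ n b)) := by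
  rw [commute_iff_eq]
  simpa only [map_mul, mapMatrix_o1, mapMatrix_o2, mapMatrix_XF, mapMatrix_DF]
    using mapMatrix_eq_of_rel (Rel.dxcom (n := n) a b h)

lemma XX_adj_two : q1 2 n (XM 2 n (1 + 1)) * Ra 2 n * q2 2 n (XM 2 n 1) =
    q2 2 n (XM 2 n 1) * R21a 2 n * q1 2 n (XM 2 n (1 + 1)) := by
  simpa only [map_mul, mapMatrix_o1, mapMatrix_o2, mapMatrix_XF, mapMatrix_Rf, mapMatrix_R21f]
    using mapMatrix_eq_of_rel (Rel.xxadj2 (n := n) rfl)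

lemma DX_adj_two (a : ZMod 2) : q1 2 n (DM 2 n a) * q2 2 n (XM 2 n (a + 1)) =
    R21ia 2 n * q2 2 n (XM 2 n (a + 1)) * q1 2 n (DM 2 n a) * R21ia 2 n := by
  simpa only [map_mul, mapMatrix_o1, mapMatrix_o2, mapMatrix_XF, mapMatrix_DF, mapMatrix_R21if]
    using mapMatrix_eq_of_rel (Rel.dxadj2' (n := n) rfl a)

lemma swapLegs_q1 (M : Matrix (Fin n) (Fin n) (Dl ℓ n)) : swapLegs (q1 ℓ n M) = q2 ℓ n M := rfl

lemma swapLegs_q2 (M : Matrix (Fin n) (Fin n) (Dl ℓ n)) : swapLegs (q2 ℓ n M) = q1 ℓ n M := rfl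

lemma swapLegs_Ra : swapLegs (Ra ℓ n) = R21a ℓ n := rfl

lemma swapLegs_R21a : swapLegs (R21a ℓ n) = Ra ℓ n := rfl

lemma swapLegs_Ria : swapLegs (Ria ℓ n) = R21ia ℓ n := swapLegs_Rm_inv

lemma XX_same_swap (a : ZMod ℓ) : Ra ℓ n * q2 ℓ n (XM ℓ n a) * q1 ℓ n (XM ℓ n a) =
    q1 ℓ n (XM ℓ n a) * q2 ℓ n (XM ℓ n a) * R21a ℓ n := by
  simpa only [map_mul, swapLegs_q1, swapLegs_q2, swapLegs_Ra, swapLegs_R21a]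
    using congrArg swapLegs (XX_same (n := n) a)

lemma DD_same_swap (a : ZMod ℓ) : Ra ℓ n * q2 ℓ n (DM ℓ n a) * q1 ℓ n (DM ℓ n a) =
    q1 ℓ n (DM ℓ n a) * q2 ℓ n (DM ℓ n a) * R21a ℓ n := by
  simpa only [map_mul, swapLegs_q1, swapLegs_q2, swapLegs_Ra, swapLegs_R21a]
    using congrArg swapLegs (DD_same (n := n) a)

lemma DX_same_swap (a : ZMod ℓ) : q1 ℓ n (DM ℓ n a) * R21ia ℓ n * q2 ℓ n (XM ℓ n a) =
    q2 ℓ n (XM ℓ n a) * R21a ℓ n * q1 ℓ n (DM ℓ n a) + scaledOm n (Dl ℓ n) := by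
  simpa only [map_mul, map_add, swapLegs_q1, swapLegs_q2, swapLegs_Ra, swapLegs_Ria,
    swapLegs_scaledOm] using congrArg swapLegs (DX_same (n := n) a)

lemma XX_succ (h : 3 ≤ ℓ) (a : ZMod ℓ) : q1 ℓ n (XM ℓ n a) * Ra ℓ n * q2 ℓ n (XM ℓ n (a + 1)) =
    q2 ℓ n (XM ℓ n (a + 1)) * q1 ℓ n (XM ℓ n a) := by
  simpa only [map_mul, swapLegs_q1, swapLegs_q2, swapLegs_R21a, add_sub_cancel_right]
    using (congrArg swapLegs (XX_pred (n := n) h (a + 1))).symm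

lemma XX_adj_two_swap : q2 2 n (XM 2 n (1 + 1)) * R21a 2 n * q1 2 n (XM 2 n 1) =
    q1 2 n (XM 2 n 1) * Ra 2 n * q2 2 n (XM 2 n (1 + 1)) := by
  simpa only [map_mul, swapLegs_q1, swapLegs_q2, swapLegs_Ra, swapLegs_R21a]
    using congrArg swapLegs (XX_adj_two (n := n))

lemma Ria_mul_Ra : Ria ℓ n * Ra ℓ n = 1 := by rw [Ra, Ria, ← ext_mul, Rm_inv_mul, ext_one]

lemma R21a_mul_R21ia : R21a ℓ n * R21ia ℓ n = 1 := by
  rw [R21a, R21ia, ← ext_mul, Rm21_mul_inv, ext_one]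

lemma R21ia_mul_R21a : R21ia ℓ n * R21a ℓ n = 1 := by
  rw [R21a, R21ia, ← ext_mul, Rm21_inv_mul, ext_one]

lemma q1_mul (M N : Matrix (Fin n) (Fin n) (Dl ℓ n)) :
    q1 ℓ n (M * N) = q1 ℓ n M * q1 ℓ n N := by simp only [q1, m1_eq_emb, map_mul]

lemma q2_mul (M N : Matrix (Fin n) (Fin n) (Dl ℓ n)) :
    q2 ℓ n (M * N) = q2 ℓ n M * q2 ℓ n N := by simp only [q2, m2_eq_emb, map_mul]

lemma q1_LY (a : ZMod ℓ) :
    q1 ℓ n (LY ℓ n a) = 1 + q1 ℓ n (XM ℓ n a) * q1 ℓ n (DM ℓ n a) := by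
  simp only [LY, q1, m1_eq_emb, map_add, map_one, map_mul]

lemma q2_LY (a : ZMod ℓ) :
    q2 ℓ n (LY ℓ n a) = 1 + q2 ℓ n (XM ℓ n a) * q2 ℓ n (DM ℓ n a) := by
  simp only [LY, q2, m2_eq_emb, map_add, map_one, map_mul]

lemma LY_X_same (a : ZMod ℓ) : q1 ℓ n (LY ℓ n a) * R21ia ℓ n * q2 ℓ n (XM ℓ n a) =
    Ra ℓ n * q2 ℓ n (XM ℓ n a) * q1 ℓ n (LY ℓ n a) := by
  rw [q1_LY]
  exact one_add_mul_exchange_left (DX_same_swap a) (XX_same_swap a) ext_Rm21_inv (mul_scaledOm _)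

lemma LY_D_same (a : ZMod ℓ) : q1 ℓ n (LY ℓ n a) * q2 ℓ n (DM ℓ n a) * R21a ℓ n =
    q2 ℓ n (DM ℓ n a) * Ria ℓ n * q1 ℓ n (LY ℓ n a) := by
  rw [q1_LY]
  exact one_add_mul_exchange_right (DX_same a) (DD_same_swap a) ext_Rm_inv
    (mul_scaledOm (q2 ℓ n (DM ℓ n a))).symm

theorem LY_reflection (a : ZMod ℓ) :
    Ria ℓ n * q1 ℓ n (LY ℓ n a) * R21ia ℓ n * q2 ℓ n (LY ℓ n a) =
      q2 ℓ n (LY ℓ n a) * Ria ℓ n * q1 ℓ n (LY ℓ n a) * R21ia ℓ n := by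
  rw [q2_LY]
  exact reflection_of_exchange (LY_X_same a) (LY_D_same a) Ria_mul_Ra R21a_mul_R21ia

section CyclicQuiver

lemma LY_X_commute (hl : 3 ≤ ℓ) {a b : ZMod ℓ} (hab : b ≠ a) (hab' : b ≠ a - 1) :
    Commute (q1 ℓ n (LY ℓ n a)) (q2 ℓ n (XM ℓ n b)) := by
  rw [q1_LY]
  refine (Commute.one_left _).add_left ?_
  by_cases hb : b = a + 1
  · subst hb
    change _ = _
    linear_combination (norm := noncomm_ring)
      q1 ℓ n (XM ℓ n a) * DX_succ (n := n) hl a + XX_succ (n := n) hl a * q1 ℓ n (DM ℓ n a)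
  · exact (XX_far ⟨hab, hb, hab'⟩).mul_left (DX_far ⟨hab, hb, hab'⟩)

lemma LY_X_pred (hl : 3 ≤ ℓ) (a : ZMod ℓ) :
    q1 ℓ n (LY ℓ n a) * q2 ℓ n (XM ℓ n (a - 1)) * R21a ℓ n =
      q2 ℓ n (XM ℓ n (a - 1)) * R21a ℓ n * q1 ℓ n (LY ℓ n a) := by
  rw [q1_LY]
  exact one_add_mul_exchange_pred (DX_pred hl a) (XX_pred hl a) R21ia_mul_R21a

lemma commute_q2_prod {M : Matrix (Idx n) (Idx n) (Dl ℓ n)}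
    {f : ℕ → Matrix (Fin n) (Fin n) (Dl ℓ n)} {m : ℕ} (h : ∀ k < m, Commute M (q2 ℓ n (f k))) :
    Commute M (q2 ℓ n ((List.range m).map f).prod) := by
  induction m with
  | zero =>
    have h1 : q2 ℓ n 1 = 1 := by simp only [q2, m2_eq_emb, map_one]
    simp [h1]
  | succ m ih =>
    rw [List.prod_range_succ, q2_mul]
    exact (ih fun k hk => h k (by omega)).mul_right (h m (by omega))

lemma natCast_ne_natCast {a b : ℕ} (hab : a < b) (hba : b < a + ℓ) : (a : ZMod ℓ) ≠ b := by
  intro h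
  have h1 := (Nat.modEq_iff_dvd' hab.le).1 ((ZMod.natCast_eq_natCast_iff a b ℓ).1 h)
  have := Nat.le_of_dvd (by omega) h1
  omega

variable (ℓ n) in
/-- The partial product `X^{(1)} ⋯ X^{(m)}`. -/
def XP (m : ℕ) : Matrix (Fin n) (Fin n) (Dl ℓ n) :=
  ((List.range m).map fun k : ℕ => XM ℓ n ((k : ZMod ℓ) + 1)).prod

variable (ℓ n) in
/-- The partial product `X^{(2)} ⋯ X^{(m+1)}`. -/
def XQ (m : ℕ) : Matrix (Fin n) (Fin n) (Dl ℓ n) :=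
  ((List.range m).map fun k : ℕ => XM ℓ n ((k : ZMod ℓ) + 2)).prod

lemma XP_succ (m : ℕ) : XP ℓ n (m + 1) = XP ℓ n m * XM ℓ n ((m : ZMod ℓ) + 1) :=
  List.prod_range_succ _ _

lemma XQ_succ (m : ℕ) : XQ ℓ n (m + 1) = XQ ℓ n m * XM ℓ n ((m : ZMod ℓ) + 2) :=
  List.prod_range_succ _ _

lemma XP_succ' (m : ℕ) : XP ℓ n (m + 1) = XM ℓ n 1 * XQ ℓ n m := by
  rw [XP, List.prod_range_succ', XQ]
  simp [add_assoc, one_add_one_eq_two]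

lemma XP_exchange (hl : 3 ≤ ℓ) (m : ℕ) (hm : m + 1 < ℓ) :
    R21a ℓ n * q1 ℓ n (XP ℓ n (m + 1)) * q2 ℓ n (XP ℓ n (m + 1)) =
      q2 ℓ n (XP ℓ n (m + 1)) * q1 ℓ n (XP ℓ n (m + 1)) * Ra ℓ n := by
  induction m with
  | zero =>
    have h : XP ℓ n (0 + 1) = XM ℓ n 1 := by simp [XP]
    rw [h]
    exact XX_same 1
  | succ m ih =>
    set c : ZMod ℓ := ((m + 1 : ℕ) : ZMod ℓ) + 1 with hc
    have hcom : Commute (q1 ℓ n (XM ℓ n c)) (q2 ℓ n (XP ℓ n m)) := by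
      refine commute_q2_prod fun k hk => XX_far ⟨?_, ?_, ?_⟩
      · refine fun h => natCast_ne_natCast (ℓ := ℓ) (a := k + 1) (b := m + 2) (by omega) (by omega) ?_
        push_cast [hc] at h ⊢
        linear_combination h
      · refine fun h => natCast_ne_natCast (ℓ := ℓ) (a := k + 1) (b := m + 3) (by omega) (by omega) ?_
        push_cast [hc] at h ⊢
        linear_combination h
      · refine fun h => natCast_ne_natCast (ℓ := ℓ) (a := k + 1) (b := m + 1) (by omega) (by omega) ?_
        push_cast [hc] at h ⊢
        linear_combination h
    have hpred : q1 ℓ n (XM ℓ n c) * q2 ℓ n (XM ℓ n ((m : ZMod ℓ) + 1)) =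
        q2 ℓ n (XM ℓ n ((m : ZMod ℓ) + 1)) * R21a ℓ n * q1 ℓ n (XM ℓ n c) := by
      have h := XX_pred (n := n) hl c
      rwa [show c - 1 = (m : ZMod ℓ) + 1 by simp [hc]] at h
    have hcb : q1 ℓ n (XM ℓ n c) * q2 ℓ n (XP ℓ n (m + 1)) =
        q2 ℓ n (XP ℓ n (m + 1)) * R21a ℓ n * q1 ℓ n (XM ℓ n c) := by
      rw [XP_succ, q2_mul]
      linear_combination (norm := noncomm_ring)
        hcom.eq * q2 ℓ n (XM ℓ n ((m : ZMod ℓ) + 1)) + q2 ℓ n (XP ℓ n m) * hpred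
    have hbc := congrArg swapLegs hcb
    simp only [map_mul, swapLegs_q1, swapLegs_q2, swapLegs_R21a] at hbc
    rw [XP_succ (m + 1), q1_mul, q2_mul]
    exact exchange_mul (ih (by omega)) (XX_same c) hcb hbc.symm

lemma Xcirc_eq_XP : Xcirc ℓ n = XP ℓ n ℓ := by
  simp only [Xcirc, XP]
  simp [← List.map_eq_flatMap, Function.comp_def]

lemma Xcirc_eq_XP_mul (m : ℕ) : Xcirc (m + 3) n = XP (m + 3) n (m + 2) * XM (m + 3) n 0 := by
  rw [Xcirc_eq_XP, XP_succ]
  congr 2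
  have := ZMod.natCast_self (m + 3)
  push_cast at this ⊢
  rw [← this]
  ring

theorem Xcirc_reflection_of_three_le (m : ℕ) :
    R21a (m + 3) n * q1 (m + 3) n (Xcirc (m + 3) n) * Ra (m + 3) n *
        q2 (m + 3) n (Xcirc (m + 3) n) =
      q2 (m + 3) n (Xcirc (m + 3) n) * R21a (m + 3) n * q1 (m + 3) n (Xcirc (m + 3) n) *
        Ra (m + 3) n := by
  have hl : 3 ≤ m + 3 := by omega
  have h0 : ((m + 3 : ℕ) : ZMod (m + 3)) = 0 := ZMod.natCast_self (m + 3)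
  have hcom : Commute (q1 (m + 3) n (XM (m + 3) n 0)) (q2 (m + 3) n (XQ (m + 3) n m)) := by
    refine commute_q2_prod fun k hk => XX_far ⟨?_, ?_, ?_⟩
    · rw [← h0]
      simpa using natCast_ne_natCast (ℓ := m + 3) (a := k + 2) (b := m + 3) (by omega) (by omega)
    · simpa using
        (natCast_ne_natCast (ℓ := m + 3) (a := 1) (b := k + 2) (by omega) (by omega)).symm
    · have h2 : (0 : ZMod (m + 3)) - 1 = ((m + 2 : ℕ) : ZMod (m + 3)) := by
        rw [← h0]; push_cast; ring
      rw [h2]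
      simpa using natCast_ne_natCast (ℓ := m + 3) (a := k + 2) (b := m + 2) (by omega) (by omega)
  have hpred := XX_pred (n := n) hl 0
  have hlast : (0 : ZMod (m + 3)) - 1 = (m : ZMod (m + 3)) + 2 := by
    rw [← h0]; push_cast; ring
  rw [hlast] at hpred
  have hsucc := XX_succ (n := n) hl 0
  rw [zero_add] at hsucc
  have hcb : q1 (m + 3) n (XM (m + 3) n 0) * Ra (m + 3) n * q2 (m + 3) n (XP (m + 3) n (m + 2)) =
      q2 (m + 3) n (XP (m + 3) n (m + 2)) * R21a (m + 3) n * q1 (m + 3) n (XM (m + 3) n 0) := by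
    rw [XP_succ', XQ_succ, q2_mul, q2_mul]
    linear_combination (norm := noncomm_ring)
      hsucc * q2 (m + 3) n (XQ (m + 3) n m) * q2 (m + 3) n (XM (m + 3) n ((m : ZMod (m + 3)) + 2)) +
        q2 (m + 3) n (XM (m + 3) n 1) * hcom.eq *
          q2 (m + 3) n (XM (m + 3) n ((m : ZMod (m + 3)) + 2)) +
        q2 (m + 3) n (XM (m + 3) n 1) * q2 (m + 3) n (XQ (m + 3) n m) * hpred
  have hbc := congrArg swapLegs hcb
  simp only [map_mul, swapLegs_q1, swapLegs_q2, swapLegs_R21a, swapLegs_Ra] at hbc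
  rw [Xcirc_eq_XP_mul, q1_mul, q2_mul]
  exact reflection_mul (XP_exchange hl (m + 1) (by omega)) (XX_same 0) hcb hbc.symm

theorem LY_Xcirc_of_three_le (m : ℕ) :
    q1 (m + 3) n (LY (m + 3) n 1) * R21ia (m + 3) n * q2 (m + 3) n (Xcirc (m + 3) n) *
        R21a (m + 3) n =
      Ra (m + 3) n * q2 (m + 3) n (Xcirc (m + 3) n) * R21a (m + 3) n *
        q1 (m + 3) n (LY (m + 3) n 1) := by
  have hl : 3 ≤ m + 3 := by omega
  have hlast := LY_X_pred (n := n) hl 1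
  rw [sub_self] at hlast
  have hcom : Commute (q1 (m + 3) n (LY (m + 3) n 1)) (q2 (m + 3) n (XQ (m + 3) n (m + 1))) := by
    refine commute_q2_prod fun k hk => LY_X_commute hl ?_ ?_
    · simpa using
        (natCast_ne_natCast (ℓ := m + 3) (a := 1) (b := k + 2) (by omega) (by omega)).symm
    · simpa using
        (natCast_ne_natCast (ℓ := m + 3) (a := 0) (b := k + 2) (by omega) (by omega)).symm
  rw [Xcirc_eq_XP_mul, XP_succ', q2_mul, q2_mul]
  exact exchange_mul_mul (LY_X_same 1) hcom hlast

end CyclicQuiver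

section TwoVertices

variable {A : Type} [Ring A]

lemma emb_e13_m1 (N : Matrix (Fin n) (Fin n) A) :
    emb (e13 n) (m1 n A N) = emb (e12 n) (m1 n A N) := by
  ext p r
  simp only [emb_apply, m1, ← ite_and]
  exact if_congr (by simp [e12, e13, and_comm]) rfl rfl

lemma emb_e23_m1 (N : Matrix (Fin n) (Fin n) A) :
    emb (e23 n) (m1 n A N) = emb (e12 n) (m2 n A N) := by
  ext p r
  simp only [emb_apply, m1, m2, ← ite_and]
  exact if_congr (by simp [e12, e23, and_comm]) rfl rfl

lemma emb_e23_m2 (N : Matrix (Fin n) (Fin n) A) :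
    emb (e23 n) (m2 n A N) = emb (e13 n) (m2 n A N) := by
  ext p r
  simp only [emb_apply, m2, ← ite_and]
  exact if_congr (by simp [e13, e23, and_comm]) rfl rfl

variable [Algebra K A]

lemma emb_ext_e23_commute_m1 (M : Matrix (Idx n) (Idx n) K) (N : Matrix (Fin n) (Fin n) A) :
    Commute (emb (e23 n) (ext n A M)) (emb (e12 n) (m1 n A N)) := by
  have h : emb (e12 n) (m1 n A N) = emb ((e23 n).trans (Equiv.prodComm _ _)) N := by
    ext p r
    simp only [emb_apply, m1, ← ite_and]
    exact if_congr (by simp [e12, e23, Prod.ext_iff, and_comm]) rfl rfl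
  rw [h]
  exact commute_emb_map_emb _ M N

lemma emb_ext_e12_commute_m2 (M : Matrix (Idx n) (Idx n) K) (N : Matrix (Fin n) (Fin n) A) :
    Commute (emb (e12 n) (ext n A M)) (emb (e13 n) (m2 n A N)) := by
  have h : emb (e13 n) (m2 n A N) = emb ((e12 n).trans (Equiv.prodComm _ _)) N := by
    ext p r
    simp only [emb_apply, m2, ← ite_and]
    exact if_congr (by simp [e12, e13, Prod.ext_iff, and_comm]) rfl rfl
  rw [h]
  exact commute_emb_map_emb _ M N

lemma emb_ext_e13_commute_m2 (M : Matrix (Idx n) (Idx n) K) (N : Matrix (Fin n) (Fin n) A) :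
    Commute (emb (e13 n) (ext n A M)) (emb (e12 n) (m2 n A N)) := by
  have h : emb (e12 n) (m2 n A N) = emb ((e13 n).trans (Equiv.prodComm _ _)) N := by
    ext p r
    simp only [emb_apply, m2, ← ite_and]
    exact if_congr (by simp [e12, e13, Prod.ext_iff, and_comm]) rfl rfl
  rw [h]
  exact commute_emb_map_emb _ M N

lemma emb_e12_scaledOm_mul_apply (M : Matrix (Idx3 n) (Idx3 n) A) (p r : Idx3 n) :
    (emb (e12 n) (scaledOm n A) * M) p r =
      algebraMap K A (qq - qq⁻¹) * M (p.2.1, p.1, p.2.2) r := by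
  have h := two_term_mul_apply (N := emb (e12 n) (scaledOm n A)) (M := M) (c := fun _ => 0)
    (d := fun _ => algebraMap K A (qq - qq⁻¹)) (s := fun p => (p.2.1, p.1, p.2.2)) (fun p r => ?_)
    p r
  · simpa using h
  · rw [emb_apply, scaledOm_apply, ← ite_and, ite_self, zero_add]
    exact if_congr (by simp [e12, Prod.ext_iff]; grind) rfl rfl

lemma mul_emb_e12_scaledOm_apply (M : Matrix (Idx3 n) (Idx3 n) A) (p r : Idx3 n) :
    (M * emb (e12 n) (scaledOm n A)) p r =
      algebraMap K A (qq - qq⁻¹) * M p (r.2.1, r.1, r.2.2) := by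
  rw [mul_apply, Finset.sum_eq_single (r.2.1, r.1, r.2.2)]
  · rw [emb_apply, scaledOm_apply, ← ite_and, if_pos ⟨rfl, rfl⟩, Algebra.commutes]
  · intro s _ hs
    rw [emb_apply, scaledOm_apply, ← ite_and, if_neg, mul_zero]
    rintro ⟨h₁, h₂⟩
    simp only [e12, Equiv.coe_fn_mk, Prod.ext_iff, Prod.fst_swap, Prod.snd_swap] at h₁ h₂
    exact hs (Prod.ext h₂.1 (Prod.ext h₂.2 h₁))
  · simp

lemma emb_e12_scaledOm_mul_e23 (M : Matrix (Idx n) (Idx n) A) :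
    emb (e12 n) (scaledOm n A) * emb (e23 n) M = emb (e13 n) M * emb (e12 n) (scaledOm n A) := by
  ext p r
  rw [emb_e12_scaledOm_mul_apply, mul_emb_e12_scaledOm_apply]
  rfl

lemma emb_e12_scaledOm_mul_e13 (M : Matrix (Idx n) (Idx n) A) :
    emb (e12 n) (scaledOm n A) * emb (e13 n) M = emb (e23 n) M * emb (e12 n) (scaledOm n A) := by
  ext p r
  rw [emb_e12_scaledOm_mul_apply, mul_emb_e12_scaledOm_apply]
  rfl

lemma ext_yang_baxter_321 :
    emb (e23 n) (ext n A (Rm21 n)) * (emb (e13 n) (ext n A (Rm21 n)) *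
        emb (e12 n) (ext n A (Rm21 n))) =
      emb (e12 n) (ext n A (Rm21 n)) * (emb (e13 n) (ext n A (Rm21 n)) *
        emb (e23 n) (ext n A (Rm21 n))) := by
  have h := congrArg (algebraMap K A).mapMatrix (yang_baxter_321 n)
  simp only [map_mul, RingHom.mapMatrix_apply, map_emb] at h
  exact h

lemma ext_yang_baxter_231 :
    emb (e23 n) (ext n A (Rm n)) * (emb (e12 n) (ext n A (Rm21 n)) *
        emb (e13 n) (ext n A (Rm21 n))) =
      emb (e13 n) (ext n A (Rm21 n)) * (emb (e12 n) (ext n A (Rm21 n)) *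
        emb (e23 n) (ext n A (Rm n))) := by
  have h := congrArg (algebraMap K A).mapMatrix (yang_baxter_231 n)
  simp only [map_mul, RingHom.mapMatrix_apply, map_emb] at h
  exact h

lemma emb_e13_XM_eq_zero : emb (e13 n) (q2 2 n (XM 2 n (1 + 1))) = 0 := by
  have hX : emb (e23 n) (q1 2 n (XM 2 n 1)) = emb (e12 n) (q2 2 n (XM 2 n 1)) := emb_e23_m1 _
  have hZ : emb (e23 n) (q2 2 n (XM 2 n (1 + 1))) = emb (e13 n) (q2 2 n (XM 2 n (1 + 1))) :=
    emb_e23_m2 _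
  have hD : emb (e13 n) (q1 2 n (DM 2 n 1)) = emb (e12 n) (q1 2 n (DM 2 n 1)) := emb_e13_m1 _
  have hdx := congrArg (emb (e12 n)) (DX_same_swap (n := n) (1 : ZMod 2))
  have hzx := congrArg (emb (e23 n)) (XX_adj_two_swap (n := n))
  have hdz := congrArg (emb (e13 n)) (DX_adj_two (n := n) 1)
  simp only [map_mul, map_add, hX, hZ, hD] at hdx hzx hdz
  have hinv : ∀ (e : Idx3 n ≃ Idx n × Fin n) {M N : Matrix (Idx n) (Idx n) (Dl 2 n)},
      M * N = 1 → emb e M * emb e N = 1 := fun e M N h => by rw [← map_mul, h, map_one]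
  refine eq_zero_of_exchange (s₃₂ := emb (e23 n) (R21ia 2 n)) (r₁₃ := emb (e13 n) (Ra 2 n))
    (r₃₁ := emb (e13 n) (R21a 2 n)) (u := emb (e12 n) (invScaledOm n _))
    (v := emb (e13 n) (invScaledOm n _)) hdx hzx hdz
    (emb_ext_e23_commute_m1 _ _).symm.eq (emb_ext_e23_commute_m1 _ _).symm.eq
    (emb_ext_e12_commute_m2 _ _).eq (emb_ext_e12_commute_m2 _ _).eq
    (emb_ext_e13_commute_m2 _ _).eq (emb_ext_e12_commute_m2 _ _).eq
    (emb_e12_scaledOm_mul_e23 _) (emb_e12_scaledOm_mul_e13 _) (hinv _ R21a_mul_R21ia) (hinv _ R21ia_mul_R21a)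
    (hinv _ R21a_mul_R21ia) (hinv _ R21ia_mul_R21a) (hinv _ R21a_mul_R21ia)
    ext_yang_baxter_321 ext_yang_baxter_231 (hinv _ scaledOm_mul_inv) ?_
  rw [← map_sub]
  refine hinv _ ?_
  rw [R21ia, ext_Rm21_inv, Ra, sub_sub_cancel, inv_mul_scaledOm]

/-- For `ℓ = 2` the defining relations are contradictory. -/
theorem subsingleton_Dl_two (hn : 1 ≤ n) : Subsingleton (Dl 2 n) := by
  have : NeZero n := ⟨by omega⟩
  have hX : q2 2 n (XM 2 n (1 + 1)) = 0 :=
    emb_injective (e13 n) (emb_e13_XM_eq_zero.trans (map_zero _).symm)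
  have h := DX_same_swap (n := n) (1 + 1 : ZMod 2)
  rw [hX, mul_zero, zero_mul, zero_mul, zero_add] at h
  have h1 : (1 : Matrix (Idx n) (Idx n) (Dl 2 n)) = 0 := by
    rw [← scaledOm_mul_inv, ← h, zero_mul]
  refine subsingleton_of_zero_eq_one ?_
  simpa using (congrFun (congrFun h1 (0, 0)) (0, 0)).symm

end TwoVertices

end Dell

namespace Statement7

open Rmatrix Dell

/--
For `ℓ ≥ 2`, the matrices `X^∘ = X^{(1)}⋯X^{(ℓ)}` and
`^LỸ^{(1)} = I + X^{(1)}D^{(1)}` over `D_ℓ` satisfy the defining relations of the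
fourth-quadrant quantum differential operator algebra `D_0^{IV}` under
`A ↦ X^∘`, `B⁻¹ ↦ ^LỸ^{(1)}`:
(i) `R₂₁ X^∘₁ R X^∘₂ = X^∘₂ R₂₁ X^∘₁ R`;
(ii) `R⁻¹ (^LỸ^{(1)})₁ R₂₁⁻¹ (^LỸ^{(1)})₂ = (^LỸ^{(1)})₂ R⁻¹ (^LỸ^{(1)})₁ R₂₁⁻¹`;
(iii) `(^LỸ^{(1)})₁ R₂₁⁻¹ X^∘₂ R₂₁ = R X^∘₂ R₂₁ (^LỸ^{(1)})₁`.
-/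
theorem statement_7 (ℓ n : ℕ) (hl : 2 ≤ ℓ) (hn : 1 ≤ n) :
    (R21a ℓ n * q1 ℓ n (Xcirc ℓ n) * Ra ℓ n * q2 ℓ n (Xcirc ℓ n)
      = q2 ℓ n (Xcirc ℓ n) * R21a ℓ n * q1 ℓ n (Xcirc ℓ n) * Ra ℓ n) ∧
    (Ria ℓ n * q1 ℓ n (LY ℓ n 1) * R21ia ℓ n * q2 ℓ n (LY ℓ n 1)
      = q2 ℓ n (LY ℓ n 1) * Ria ℓ n * q1 ℓ n (LY ℓ n 1) * R21ia ℓ n) ∧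
    (q1 ℓ n (LY ℓ n 1) * R21ia ℓ n * q2 ℓ n (Xcirc ℓ n) * R21a ℓ n
      = Ra ℓ n * q2 ℓ n (Xcirc ℓ n) * R21a ℓ n * q1 ℓ n (LY ℓ n 1)) := by
  refine ⟨?_, LY_reflection 1, ?_⟩
  · obtain rfl | hl3 := hl.eq_or_lt
    · have := subsingleton_Dl_two hn
      exact Subsingleton.elim _ _
    · obtain ⟨m, rfl⟩ := Nat.exists_eq_add_of_le' hl3
      exact Xcirc_reflection_of_three_le m
  · obtain rfl | hl3 := hl.eq_or_lt
    · have := subsingleton_Dl_two hn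
      exact Subsingleton.elim _ _
    · obtain ⟨m, rfl⟩ := Nat.exists_eq_add_of_le' hl3
      exact LY_Xcirc_of_three_le m

end Statement7
end
end

section
/- Let T be the free ℂ(q)-algebra on generators x_{ij}, ∂_{ij} (1 ≤ i,j ≤ n), with T_X and T_D the subalgebras generated by the x_{ij} and by the ∂_{ij} respectively. Let I_X be the two-sided ideal of T_X generated by the entries of R_{21}X_1RX_2 − X_2R_{21}X_1R, let I_D be the two-sided ideal of T_D generated by the entries of R^{−1}D_1R_{21}^{−1}D_2 − D_2R^{−1}D_1R_{21}^{−1}, and let I_{DX} be the two-sided ideal of T generated by the entries of D_1R_{21}^{−1}X_2R_{21} − RX_2R_{21}D_1 − (q−q^{−1})RΩ. Then T_X·I_D ⊆ I_D·T_X + I_{DX} and I_X·T_D ⊆ T_D·I_X + I_{DX} (as subsets of T). -/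
noncomputable section
open scoped BigOperators

namespace Statement14

open Rmatrix

/-- Free generators `x_ij`, `∂_ij`. -/
inductive Gen (n : ℕ) : Type
  | x : Fin n → Fin n → Gen n
  | d : Fin n → Fin n → Gen n

/-- The free algebra `T` on the generators `x_ij`, `∂_ij`. -/
abbrev T (n : ℕ) := FreeAlgebra K (Gen n)

def xF (n : ℕ) : Matrix (Fin n) (Fin n) (T n) := fun i j => FreeAlgebra.ι K (Gen.x i j)
def dF (n : ℕ) : Matrix (Fin n) (Fin n) (T n) := fun i j => FreeAlgebra.ι K (Gen.d i j)

/-- The subalgebra `T_X` generated by the `x_ij`, as a subset of `T`. -/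
def TXs (n : ℕ) : Set (T n) :=
  (Algebra.adjoin K (Set.range fun p : Fin n × Fin n => xF n p.1 p.2) : Subalgebra K (T n))

/-- The subalgebra `T_D` generated by the `∂_ij`, as a subset of `T`. -/
def TDs (n : ℕ) : Set (T n) :=
  (Algebra.adjoin K (Set.range fun p : Fin n × Fin n => dF n p.1 p.2) : Subalgebra K (T n))

/-- The entries of `R₂₁X₁RX₂ − X₂R₂₁X₁R`. -/
def entX (n : ℕ) : Set (T n) :=
  {y | ∃ p r : Idx n,
    y = (ext n (T n) (Rm21 n) * m1 n (T n) (xF n) * ext n (T n) (Rm n) * m2 n (T n) (xF n) -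
          m2 n (T n) (xF n) * ext n (T n) (Rm21 n) * m1 n (T n) (xF n) *
            ext n (T n) (Rm n)) p r}

/-- The entries of `R⁻¹D₁R₂₁⁻¹D₂ − D₂R⁻¹D₁R₂₁⁻¹`. -/
def entD (n : ℕ) : Set (T n) :=
  {y | ∃ p r : Idx n,
    y = (ext n (T n) (Rm n)⁻¹ * m1 n (T n) (dF n) * ext n (T n) (Rm21 n)⁻¹ *
            m2 n (T n) (dF n) -
          m2 n (T n) (dF n) * ext n (T n) (Rm n)⁻¹ * m1 n (T n) (dF n) *
            ext n (T n) (Rm21 n)⁻¹) p r}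

/-- The entries of `D₁R₂₁⁻¹X₂R₂₁ − RX₂R₂₁D₁ − (q−q⁻¹)RΩ`. -/
def entDX (n : ℕ) : Set (T n) :=
  {y | ∃ p r : Idx n,
    y = (m1 n (T n) (dF n) * ext n (T n) (Rm21 n)⁻¹ * m2 n (T n) (xF n) *
            ext n (T n) (Rm21 n) -
          ext n (T n) (Rm n) * m2 n (T n) (xF n) * ext n (T n) (Rm21 n) * m1 n (T n) (dF n) -
          (qq - qq⁻¹) • (ext n (T n) (Rm n) * Om n (T n))) p r}

/-- The two-sided ideal `I_X` of `T_X` generated by `entX`, as a submodule of `T`. -/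
def IX (n : ℕ) : Submodule K (T n) :=
  Submodule.span K {y | ∃ a ∈ TXs n, ∃ e ∈ entX n, ∃ b ∈ TXs n, y = a * e * b}

/-- The two-sided ideal `I_D` of `T_D` generated by `entD`, as a submodule of `T`. -/
def ID (n : ℕ) : Submodule K (T n) :=
  Submodule.span K {y | ∃ a ∈ TDs n, ∃ e ∈ entD n, ∃ b ∈ TDs n, y = a * e * b}

/-- The two-sided ideal `I_{DX}` of `T` generated by `entDX`. -/
def IDX (n : ℕ) : Submodule K (T n) :=
  Submodule.span K {y | ∃ a : T n, ∃ e ∈ entDX n, ∃ b : T n, y = a * e * b}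

/-- A family of `R`-matrices `R a b`, their inverses `Q a b` and the flips `P a b` acting on three
tensor factors, subject to the Yang–Baxter equation and the Hecke relation. -/
structure IsHeckeFamily {B : Type*} [Ring B] [Algebra K B] (lam : K)
    (R Q P : Fin 3 → Fin 3 → B) : Prop where
  R_mul_Q : ∀ a b, a ≠ b → R a b * Q a b = 1
  Q_mul_R : ∀ a b, a ≠ b → Q a b * R a b = 1
  yangBaxter : ∀ a b c, a ≠ b → a ≠ c → b ≠ c →
    R a b * R a c * R b c = R b c * R a c * R a b
  hecke : ∀ a b, a ≠ b → R a b = Q b a + lam • P a b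
  P_comm : ∀ a b, a ≠ b → P a b = P b a
  P_mul_R : ∀ a b c d, a ≠ b → c ≠ d →
    P a b * R c d = R (Equiv.swap a b c) (Equiv.swap a b d) * P a b
  P_mul_Q : ∀ a b c d, a ≠ b → c ≠ d →
    P a b * Q c d = Q (Equiv.swap a b c) (Equiv.swap a b d) * P a b
  P_mul_P : ∀ a b c d, a ≠ b → c ≠ d →
    P a b * P c d = P (Equiv.swap a b c) (Equiv.swap a b d) * P a b

/-- A matrix placed in each of the three tensor factors, compatibly with a Hecke family. -/
structure IsSiteFamily {B : Type*} [Ring B] (R Q P : Fin 3 → Fin 3 → B) (X : Fin 3 → B) :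
    Prop where
  comm_R : ∀ a b c, a ≠ b → a ≠ c → b ≠ c → R b c * X a = X a * R b c
  comm_Q : ∀ a b c, a ≠ b → a ≠ c → b ≠ c → Q b c * X a = X a * Q b c
  P_mul : ∀ a b c, a ≠ b → P a b * X c = X (Equiv.swap a b c) * P a b

namespace IsHeckeFamily

variable {B : Type*} [Ring B] [Algebra K B] {lam : K} {R Q P : Fin 3 → Fin 3 → B}

theorem R_Q_cancel (h : IsHeckeFamily lam R Q P) {a b : Fin 3} (hab : a ≠ b) (w : B) :
    R a b * (Q a b * w) = w := by
  rw [← mul_assoc, h.R_mul_Q a b hab, one_mul]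

theorem Q_R_cancel (h : IsHeckeFamily lam R Q P) {a b : Fin 3} (hab : a ≠ b) (w : B) :
    Q a b * (R a b * w) = w := by
  rw [← mul_assoc, h.Q_mul_R a b hab, one_mul]

theorem yangBaxter_apply (h : IsHeckeFamily lam R Q P) {a b c : Fin 3} (hab : a ≠ b)
    (hac : a ≠ c) (hbc : b ≠ c) (w : B) :
    R a b * (R a c * (R b c * w)) = R b c * (R a c * (R a b * w)) := by
  simpa only [mul_assoc] using congrArg (· * w) (h.yangBaxter a b c hab hac hbc)

theorem R_R_Q (h : IsHeckeFamily lam R Q P) {a b c : Fin 3} (hab : a ≠ b)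
    (hac : a ≠ c) (hbc : b ≠ c) (w : B) :
    R a c * (R a b * (Q b c * w)) = Q b c * (R a b * (R a c * w)) := by
  rw [← h.Q_R_cancel hbc (R a c * (R a b * (Q b c * w))),
    ← h.yangBaxter_apply hab hac hbc, h.R_Q_cancel hbc]

theorem R_Q_Q (h : IsHeckeFamily lam R Q P) {a b c : Fin 3} (hab : a ≠ b)
    (hac : a ≠ c) (hbc : b ≠ c) (w : B) :
    R b c * (Q a b * (Q a c * w)) = Q a c * (Q a b * (R b c * w)) := by
  rw [← h.Q_R_cancel hac (R b c * (Q a b * (Q a c * w))),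
    ← h.Q_R_cancel hab (R a c * (R b c * (Q a b * (Q a c * w)))),
    h.yangBaxter_apply hab hac hbc, h.R_Q_cancel hab, h.R_Q_cancel hac]

theorem R_Q_Q' (h : IsHeckeFamily lam R Q P) {a b c : Fin 3} (hab : a ≠ b)
    (hac : a ≠ c) (hbc : b ≠ c) (w : B) :
    R a b * (Q b c * (Q a c * w)) = Q a c * (Q b c * (R a b * w)) := by
  rw [← h.Q_R_cancel hac (R a b * (Q b c * (Q a c * w))),
    ← h.Q_R_cancel hbc (R a c * (R a b * (Q b c * (Q a c * w)))),
    ← h.yangBaxter_apply hab hac hbc, h.R_Q_cancel hbc, h.R_Q_cancel hac]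

theorem Q_Q_Q (h : IsHeckeFamily lam R Q P) {a b c : Fin 3} (hab : a ≠ b)
    (hac : a ≠ c) (hbc : b ≠ c) (w : B) :
    Q b c * (Q a c * (Q a b * w)) = Q a b * (Q a c * (Q b c * w)) := by
  rw [← h.Q_R_cancel hab (Q b c * (Q a c * (Q a b * w))), h.R_Q_Q' hab hac hbc,
    h.R_Q_cancel hab]

theorem P_R_apply (h : IsHeckeFamily lam R Q P) {a b c d c' d' : Fin 3} (hab : a ≠ b)
    (hcd : c ≠ d) (hc : Equiv.swap a b c = c') (hd : Equiv.swap a b d = d') (w : B) :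
    P a b * (R c d * w) = R c' d' * (P a b * w) := by
  rw [← mul_assoc, h.P_mul_R a b c d hab hcd, hc, hd, mul_assoc]

theorem P_Q_apply (h : IsHeckeFamily lam R Q P) {a b c d c' d' : Fin 3} (hab : a ≠ b)
    (hcd : c ≠ d) (hc : Equiv.swap a b c = c') (hd : Equiv.swap a b d = d') (w : B) :
    P a b * (Q c d * w) = Q c' d' * (P a b * w) := by
  rw [← mul_assoc, h.P_mul_Q a b c d hab hcd, hc, hd, mul_assoc]

theorem P_P_apply (h : IsHeckeFamily lam R Q P) {a b c d c' d' : Fin 3} (hab : a ≠ b)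
    (hcd : c ≠ d) (hc : Equiv.swap a b c = c') (hd : Equiv.swap a b d = d') (w : B) :
    P a b * (P c d * w) = P c' d' * (P a b * w) := by
  rw [← mul_assoc, h.P_mul_P a b c d hab hcd, hc, hd, mul_assoc]

end IsHeckeFamily

namespace IsSiteFamily

variable {B : Type*} [Ring B] {R Q P : Fin 3 → Fin 3 → B} {X : Fin 3 → B}

theorem R_apply (h : IsSiteFamily R Q P X) {a b c : Fin 3} (hab : a ≠ b) (hac : a ≠ c)
    (hbc : b ≠ c) (w : B) : R b c * (X a * w) = X a * (R b c * w) := by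
  rw [← mul_assoc, h.comm_R a b c hab hac hbc, mul_assoc]

theorem Q_apply (h : IsSiteFamily R Q P X) {a b c : Fin 3} (hab : a ≠ b) (hac : a ≠ c)
    (hbc : b ≠ c) (w : B) : Q b c * (X a * w) = X a * (Q b c * w) := by
  rw [← mul_assoc, h.comm_Q a b c hab hac hbc, mul_assoc]

theorem P_apply (h : IsSiteFamily R Q P X) {a b c c' : Fin 3} (hab : a ≠ b)
    (hc : Equiv.swap a b c = c') (w : B) : P a b * (X c * w) = X c' * (P a b * w) := by
  rw [← mul_assoc, h.P_mul a b c hab, hc, mul_assoc]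

end IsSiteFamily

section Exchange

variable {B : Type*} [Ring B] [Algebra K B] {lam : K} {R Q P : Fin 3 → Fin 3 → B}
  {X D : Fin 3 → B}

theorem cross_apply
    (hXD : ∀ a b, a ≠ b →
      X b * R b a * D a = Q a b * D a * Q b a * X b * R b a - lam • P a b)
    {a b : Fin 3} (hab : a ≠ b) (w : B) :
    X b * (R b a * (D a * w)) =
      Q a b * (D a * (Q b a * (X b * (R b a * w)))) - lam • (P a b * w) := by
  simpa only [mul_assoc, sub_mul, smul_mul_assoc] using congrArg (· * w) (hXD a b hab)

theorem x_move_first (h : IsHeckeFamily lam R Q P) (hX : IsSiteFamily R Q P X)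
    (hD : IsSiteFamily R Q P D)
    (hXD : ∀ a b, a ≠ b →
      X b * R b a * D a = Q a b * D a * Q b a * X b * R b a - lam • P a b) (w : B) :
    X 2 * (R 2 1 * (R 2 0 * (Q 0 1 * (D 0 * (Q 1 0 * (D 1 * w)))))) =
      Q 1 2 * (Q 0 2 * (Q 0 1 * (D 0 * (Q 1 0 * (D 1 * (Q 2 0 * (Q 2 1 * (X 2 * (R 2 1 * (R 2 0 * w)))))))))) -
        lam • (Q 0 1 * (Q 0 2 * (D 0 * (Q 2 0 * (Q 1 0 * (P 1 2 * (R 2 0 * w))))))) -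
        lam • (Q 0 1 * (P 0 2 * (R 2 1 * (Q 1 0 * (D 1 * w))))) := by
  rw [h.R_R_Q (a := 2) (b := 0) (c := 1) (by decide) (by decide) (by decide),
    ← hX.Q_apply (a := 2) (b := 0) (c := 1) (by decide) (by decide) (by decide),
    hD.R_apply (a := 0) (b := 2) (c := 1) (by decide) (by decide) (by decide),
    cross_apply hXD (a := 0) (b := 2) (by decide),
    mul_sub,
    mul_smul_comm,
    h.R_R_Q (a := 2) (b := 1) (c := 0) (by decide) (by decide) (by decide),
    ← hX.Q_apply (a := 2) (b := 1) (c := 0) (by decide) (by decide) (by decide),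
    hD.R_apply (a := 1) (b := 2) (c := 0) (by decide) (by decide) (by decide),
    cross_apply hXD (a := 1) (b := 2) (by decide),
    mul_sub, mul_smul_comm,
    mul_sub, mul_smul_comm,
    mul_sub, mul_smul_comm,
    mul_sub, mul_smul_comm,
    mul_sub, mul_smul_comm,
    h.Q_Q_Q (a := 1) (b := 2) (c := 0) (by decide) (by decide) (by decide),
    ← hD.Q_apply (a := 0) (b := 1) (c := 2) (by decide) (by decide) (by decide),
    ← h.Q_Q_Q (a := 0) (b := 1) (c := 2) (by decide) (by decide) (by decide),
    hD.Q_apply (a := 1) (b := 2) (c := 0) (by decide) (by decide) (by decide)]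

theorem x_move_second (h : IsHeckeFamily lam R Q P) (hX : IsSiteFamily R Q P X)
    (hD : IsSiteFamily R Q P D)
    (hXD : ∀ a b, a ≠ b →
      X b * R b a * D a = Q a b * D a * Q b a * X b * R b a - lam • P a b) (w : B) :
    X 2 * (R 2 1 * (R 2 0 * (D 1 * (Q 0 1 * (D 0 * (Q 1 0 * w)))))) =
      Q 1 2 * (Q 0 2 * (D 1 * (Q 0 1 * (D 0 * (Q 1 0 * (Q 2 0 * (Q 2 1 * (X 2 * (R 2 1 * (R 2 0 * w)))))))))) -
        lam • (Q 1 2 * (D 1 * (Q 2 1 * (Q 0 1 * (P 0 2 * (R 2 1 * (Q 1 0 * w))))))) -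
        lam • (P 1 2 * (R 2 0 * (Q 0 1 * (D 0 * (Q 1 0 * w))))) := by
  rw [hD.R_apply (a := 1) (b := 2) (c := 0) (by decide) (by decide) (by decide),
    cross_apply hXD (a := 1) (b := 2) (by decide),
    h.R_R_Q (a := 2) (b := 0) (c := 1) (by decide) (by decide) (by decide),
    ← hX.Q_apply (a := 2) (b := 0) (c := 1) (by decide) (by decide) (by decide),
    hD.R_apply (a := 0) (b := 2) (c := 1) (by decide) (by decide) (by decide),
    cross_apply hXD (a := 0) (b := 2) (by decide),
    mul_sub, mul_smul_comm,
    mul_sub, mul_smul_comm,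
    mul_sub, mul_smul_comm,
    mul_sub, mul_smul_comm,
    h.R_R_Q (a := 2) (b := 1) (c := 0) (by decide) (by decide) (by decide),
    ← hX.Q_apply (a := 2) (b := 1) (c := 0) (by decide) (by decide) (by decide),
    h.Q_Q_Q (a := 0) (b := 2) (c := 1) (by decide) (by decide) (by decide),
    ← hD.Q_apply (a := 1) (b := 0) (c := 2) (by decide) (by decide) (by decide),
    hD.Q_apply (a := 0) (b := 2) (c := 1) (by decide) (by decide) (by decide),
    ← h.Q_Q_Q (a := 2) (b := 1) (c := 0) (by decide) (by decide) (by decide)]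

theorem d_move_first (h : IsHeckeFamily lam R Q P) (hX : IsSiteFamily R Q P X)
    (hD : IsSiteFamily R Q P D)
    (hXD : ∀ a b, a ≠ b →
      X b * R b a * D a = Q a b * D a * Q b a * X b * R b a - lam • P a b) (w : B) :
    R 1 0 * (X 0 * (R 0 1 * (X 1 * (R 0 2 * (R 1 2 * (D 2 * w)))))) =
      Q 2 0 * (Q 2 1 * (D 2 * (Q 1 2 * (Q 0 2 * (R 1 0 * (X 0 * (R 0 1 * (X 1 * (R 0 2 * (R 1 2 * w)))))))))) -
        lam • (R 1 0 * (Q 2 1 * (P 2 0 * (R 0 1 * (Q 1 2 * (X 1 * (R 1 2 * w))))))) -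
        lam • (R 1 0 * (X 0 * (R 0 1 * (R 0 2 * (P 2 1 * w))))) := by
  rw [← hX.R_apply (a := 1) (b := 0) (c := 2) (by decide) (by decide) (by decide),
    cross_apply hXD (a := 2) (b := 1) (by decide),
    mul_sub, mul_smul_comm,
    mul_sub, mul_smul_comm,
    mul_sub, mul_smul_comm,
    mul_sub, mul_smul_comm,
    h.R_R_Q (a := 0) (b := 2) (c := 1) (by decide) (by decide) (by decide),
    ← hX.Q_apply (a := 0) (b := 2) (c := 1) (by decide) (by decide) (by decide),
    hD.R_apply (a := 2) (b := 0) (c := 1) (by decide) (by decide) (by decide),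
    cross_apply hXD (a := 2) (b := 0) (by decide),
    mul_sub, mul_smul_comm,
    mul_sub, mul_smul_comm,
    h.R_Q_Q (a := 2) (b := 1) (c := 0) (by decide) (by decide) (by decide),
    h.R_R_Q (a := 0) (b := 1) (c := 2) (by decide) (by decide) (by decide),
    ← hX.Q_apply (a := 0) (b := 1) (c := 2) (by decide) (by decide) (by decide),
    hD.R_apply (a := 2) (b := 1) (c := 0) (by decide) (by decide) (by decide),
    ← h.R_Q_Q' (a := 1) (b := 0) (c := 2) (by decide) (by decide) (by decide),
    hX.R_apply (a := 1) (b := 0) (c := 2) (by decide) (by decide) (by decide)]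

theorem d_move_second (h : IsHeckeFamily lam R Q P) (hX : IsSiteFamily R Q P X)
    (hD : IsSiteFamily R Q P D)
    (hXD : ∀ a b, a ≠ b →
      X b * R b a * D a = Q a b * D a * Q b a * X b * R b a - lam • P a b) (w : B) :
    X 1 * (R 1 0 * (X 0 * (R 0 1 * (R 0 2 * (R 1 2 * (D 2 * w)))))) =
      Q 2 0 * (Q 2 1 * (D 2 * (Q 1 2 * (Q 0 2 * (X 1 * (R 1 0 * (X 0 * (R 0 1 * (R 0 2 * (R 1 2 * w)))))))))) -
        lam • (Q 2 0 * (P 2 1 * (R 1 0 * (Q 0 2 * (X 0 * (R 0 2 * (R 0 1 * w))))))) -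
        lam • (X 1 * (R 1 0 * (R 1 2 * (P 2 0 * (R 0 1 * w))))) := by
  rw [h.yangBaxter_apply (a := 0) (b := 1) (c := 2) (by decide) (by decide) (by decide),
    hD.R_apply (a := 2) (b := 0) (c := 1) (by decide) (by decide) (by decide),
    ← hX.R_apply (a := 0) (b := 1) (c := 2) (by decide) (by decide) (by decide),
    cross_apply hXD (a := 2) (b := 0) (by decide),
    mul_sub, mul_smul_comm,
    mul_sub, mul_smul_comm,
    mul_sub, mul_smul_comm,
    h.R_R_Q (a := 1) (b := 2) (c := 0) (by decide) (by decide) (by decide),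
    ← hX.Q_apply (a := 1) (b := 2) (c := 0) (by decide) (by decide) (by decide),
    hD.R_apply (a := 2) (b := 1) (c := 0) (by decide) (by decide) (by decide),
    cross_apply hXD (a := 2) (b := 1) (by decide),
    mul_sub, mul_smul_comm,
    h.R_R_Q (a := 1) (b := 0) (c := 2) (by decide) (by decide) (by decide),
    ← hX.Q_apply (a := 1) (b := 0) (c := 2) (by decide) (by decide) (by decide),
    hX.R_apply (a := 0) (b := 1) (c := 2) (by decide) (by decide) (by decide),
    ← h.yangBaxter_apply (a := 0) (b := 1) (c := 2) (by decide) (by decide) (by decide)]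

theorem x_move_lower (h : IsHeckeFamily lam R Q P) (hD : IsSiteFamily R Q P D) (w : B) :
    Q 0 1 * (Q 0 2 * (D 0 * (Q 2 0 * (Q 1 0 * (P 1 2 * (R 2 0 * w)))))) +
        Q 0 1 * (P 0 2 * (R 2 1 * (Q 1 0 * (D 1 * w)))) =
      P 1 2 * (R 2 0 * (Q 0 1 * (D 0 * (Q 1 0 * w)))) +
        Q 1 2 * (D 1 * (Q 2 1 * (Q 0 1 * (P 0 2 * (R 2 1 * (Q 1 0 * w)))))) := by
  rw [h.P_R_apply (a := 1) (b := 2) (c := 2) (d := 0) (c' := 1) (d' := 0)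
      (by decide) (by decide) (by decide) (by decide),
    h.Q_R_cancel (a := 1) (b := 0) (by decide),
    h.P_R_apply (a := 0) (b := 2) (c := 2) (d := 1) (c' := 0) (d' := 1)
      (by decide) (by decide) (by decide) (by decide),
    h.Q_R_cancel (a := 0) (b := 1) (by decide),
    h.P_Q_apply (a := 0) (b := 2) (c := 1) (d := 0) (c' := 1) (d' := 2)
      (by decide) (by decide) (by decide) (by decide),
    hD.P_apply (a := 0) (b := 2) (c := 1) (c' := 1) (by decide) (by decide),
    h.P_R_apply (a := 1) (b := 2) (c := 2) (d := 0) (c' := 1) (d' := 0)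
      (by decide) (by decide) (by decide) (by decide),
    h.P_Q_apply (a := 1) (b := 2) (c := 0) (d := 1) (c' := 0) (d' := 2)
      (by decide) (by decide) (by decide) (by decide),
    hD.P_apply (a := 1) (b := 2) (c := 0) (c' := 0) (by decide) (by decide),
    h.P_Q_apply (a := 1) (b := 2) (c := 1) (d := 0) (c' := 2) (d' := 0)
      (by decide) (by decide) (by decide) (by decide),
    h.P_R_apply (a := 0) (b := 2) (c := 2) (d := 1) (c' := 0) (d' := 1)
      (by decide) (by decide) (by decide) (by decide),
    h.Q_R_cancel (a := 0) (b := 1) (by decide),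
    h.P_Q_apply (a := 0) (b := 2) (c := 1) (d := 0) (c' := 1) (d' := 2)
      (by decide) (by decide) (by decide) (by decide)]
  have e1 : ∀ z, R 1 0 * z = Q 0 1 * z + lam • (P 0 1 * z) := fun z => by
    rw [h.hecke 1 0 (by decide), h.P_comm 1 0 (by decide), add_mul, smul_mul_assoc]
  have e2 : ∀ z, z = Q 2 1 * (Q 1 2 * z) + lam • (Q 2 1 * (P 1 2 * z)) := fun z => by
    rw [← mul_smul_comm, ← mul_add, ← smul_mul_assoc, ← add_mul, h.P_comm 1 2 (by decide),
      ← h.hecke 2 1 (by decide), h.Q_R_cancel (by decide)]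
  rw [e1, add_assoc]
  nth_rewrite 1 [e2 (P 0 2 * w)]
  rw [h.P_P_apply (a := 1) (b := 2) (c := 0) (d := 2) (c' := 0) (d' := 1)
      (by decide) (by decide) (by decide) (by decide),
    h.P_Q_apply (a := 0) (b := 1) (c := 0) (d := 2) (c' := 1) (d' := 2)
      (by decide) (by decide) (by decide) (by decide),
    hD.P_apply (a := 0) (b := 1) (c := 0) (c' := 1) (by decide) (by decide),
    h.P_Q_apply (a := 0) (b := 1) (c := 2) (d := 0) (c' := 2) (d' := 1)
      (by decide) (by decide) (by decide) (by decide)]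
  simp only [mul_add, mul_smul_comm]
  abel

theorem d_move_lower (h : IsHeckeFamily lam R Q P) (hX : IsSiteFamily R Q P X) (w : B) :
    R 1 0 * (Q 2 1 * (P 2 0 * (R 0 1 * (Q 1 2 * (X 1 * (R 1 2 * w)))))) +
        R 1 0 * (X 0 * (R 0 1 * (R 0 2 * (P 2 1 * w)))) =
      Q 2 0 * (P 2 1 * (R 1 0 * (Q 0 2 * (X 0 * (R 0 2 * (R 0 1 * w)))))) +
        X 1 * (R 1 0 * (R 1 2 * (P 2 0 * (R 0 1 * w)))) := by
  rw [h.P_R_apply (a := 2) (b := 0) (c := 0) (d := 1) (c' := 2) (d' := 1)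
      (by decide) (by decide) (by decide) (by decide),
    h.Q_R_cancel (a := 2) (b := 1) (by decide),
    h.P_Q_apply (a := 2) (b := 0) (c := 1) (d := 2) (c' := 1) (d' := 0)
      (by decide) (by decide) (by decide) (by decide),
    hX.P_apply (a := 2) (b := 0) (c := 1) (c' := 1) (by decide) (by decide),
    h.P_R_apply (a := 2) (b := 0) (c := 1) (d := 2) (c' := 1) (d' := 0)
      (by decide) (by decide) (by decide) (by decide),
    h.R_Q_cancel (a := 1) (b := 0) (by decide),
    h.P_R_apply (a := 2) (b := 1) (c := 1) (d := 0) (c' := 2) (d' := 0)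
      (by decide) (by decide) (by decide) (by decide),
    h.P_Q_apply (a := 2) (b := 1) (c := 0) (d := 2) (c' := 0) (d' := 1)
      (by decide) (by decide) (by decide) (by decide),
    hX.P_apply (a := 2) (b := 1) (c := 0) (c' := 0) (by decide) (by decide),
    h.P_R_apply (a := 2) (b := 1) (c := 0) (d := 2) (c' := 0) (d' := 1)
      (by decide) (by decide) (by decide) (by decide),
    h.P_R_apply (a := 2) (b := 1) (c := 0) (d := 1) (c' := 0) (d' := 2)
      (by decide) (by decide) (by decide) (by decide),
    h.Q_R_cancel (a := 2) (b := 0) (by decide)]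
  have e1 : ∀ z, R 1 0 * z = Q 0 1 * z + lam • (P 0 1 * z) := fun z => by
    rw [h.hecke 1 0 (by decide), h.P_comm 1 0 (by decide), add_mul, smul_mul_assoc]
  have e2 : ∀ z, R 1 2 * (R 2 1 * z) = z + lam • (R 1 2 * (P 2 1 * z)) := fun z => by
    rw [h.hecke 2 1 (by decide), add_mul, mul_add, h.R_Q_cancel (by decide), smul_mul_assoc,
      mul_smul_comm]
  rw [h.P_R_apply (a := 2) (b := 0) (c := 0) (d := 1) (c' := 2) (d' := 1)
      (by decide) (by decide) (by decide) (by decide), e2, e1 (X 0 * _), h.P_comm 0 1 (by decide)]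
  rw [h.P_P_apply (a := 2) (b := 1) (c := 2) (d := 0) (c' := 1) (d' := 0)
      (by decide) (by decide) (by decide) (by decide)]
  rw [hX.P_apply (a := 1) (b := 0) (c := 0) (c' := 1) (by decide) (by decide),
    h.P_R_apply (a := 1) (b := 0) (c := 0) (d := 1) (c' := 1) (d' := 0)
      (by decide) (by decide) (by decide) (by decide),
    h.P_R_apply (a := 1) (b := 0) (c := 0) (d := 2) (c' := 1) (d' := 2)
      (by decide) (by decide) (by decide) (by decide)]
  simp only [mul_add, mul_smul_comm]
  abel

end Exchange

section Exchange

variable {B : Type*} [Ring B] [Algebra K B] {lam : K} {R Q P : Fin 3 → Fin 3 → B}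
  {X D : Fin 3 → B}

/-- Moving `X` in the third factor past the quantum-space relation for `D` in the first two. -/
theorem x_move_relation (h : IsHeckeFamily lam R Q P) (hX : IsSiteFamily R Q P X)
    (hD : IsSiteFamily R Q P D)
    (hXD : ∀ a b, a ≠ b →
      X b * R b a * D a = Q a b * D a * Q b a * X b * R b a - lam • P a b) :
    X 2 * (R 2 1 * (R 2 0 * (Q 0 1 * D 0 * Q 1 0 * D 1 - D 1 * Q 0 1 * D 0 * Q 1 0))) =
      Q 1 2 * (Q 0 2 * ((Q 0 1 * D 0 * Q 1 0 * D 1 - D 1 * Q 0 1 * D 0 * Q 1 0) *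
        (Q 2 0 * (Q 2 1 * (X 2 * (R 2 1 * R 2 0)))))) := by
  have h1 := x_move_first h hX hD hXD 1
  have h2 := x_move_second h hX hD hXD 1
  have h3 := congrArg (lam • ·) (x_move_lower h hD (1 : B))
  simp only [mul_one, smul_add] at h1 h2 h3
  rw [sub_sub, h3] at h1
  simp only [mul_sub, sub_mul, mul_assoc]
  rw [h1, h2]
  abel

/-- Moving `D` in the third factor past the quantum-space relation for `X` in the first two. -/
theorem d_move_relation (h : IsHeckeFamily lam R Q P) (hX : IsSiteFamily R Q P X)
    (hD : IsSiteFamily R Q P D)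
    (hXD : ∀ a b, a ≠ b →
      X b * R b a * D a = Q a b * D a * Q b a * X b * R b a - lam • P a b) :
    (R 1 0 * X 0 * R 0 1 * X 1 - X 1 * R 1 0 * X 0 * R 0 1) * (R 0 2 * (R 1 2 * D 2)) =
      Q 2 0 * (Q 2 1 * (D 2 * (Q 1 2 * (Q 0 2 *
        ((R 1 0 * X 0 * R 0 1 * X 1 - X 1 * R 1 0 * X 0 * R 0 1) * (R 0 2 * R 1 2)))))) := by
  have h1 := d_move_first h hX hD hXD 1
  have h2 := d_move_second h hX hD hXD 1
  have h3 := congrArg (lam • ·) (d_move_lower h hX (1 : B))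
  simp only [mul_one, smul_add] at h1 h2 h3
  rw [sub_sub, h3] at h1
  simp only [mul_sub, sub_mul, mul_assoc]
  rw [h1, h2]
  abel

end Exchange

section Embedding

/-- The tensor factor different from `a` and `b`, when these are distinct. -/
def third (a b : Fin 3) : Fin 3 := -(a + b)

theorem third_ne_left {a b : Fin 3} (h : a ≠ b) : third a b ≠ a := by
  revert h; revert a b; decide

theorem third_ne_right {a b : Fin 3} (h : a ≠ b) : third a b ≠ b := by
  revert h; revert a b; decide

theorem eq_or_eq_or_eq_third {a b : Fin 3} (h : a ≠ b) (t : Fin 3) :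
    t = a ∨ t = b ∨ t = third a b := by
  revert h t; revert a b; decide

theorem map_third (σ : Equiv.Perm (Fin 3)) {a b : Fin 3} (h : a ≠ b) :
    σ (third a b) = third (σ a) (σ b) := by
  revert h; revert σ a b; decide

theorem eq_add_one_or_eq_add_two {a b : Fin 3} (h : a ≠ b) :
    b = a + 1 ∧ third a b = a + 2 ∨ b = a + 2 ∧ third a b = a + 1 := by
  revert h; revert a b; decide

theorem third_comm (a b : Fin 3) : third a b = third b a := by
  rw [third, third, add_comm]

theorem third_left (a b : Fin 3) : third (third a b) a = b := by
  revert a b; decide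

variable {n : ℕ} {A : Type} [Ring A]

/-- The entries of a multi-index in the tensor factors `a`, `b` and in the remaining factor
`third a b`. -/
def splitIdx (a b : Fin 3) (p : Fin 3 → Fin n) : Idx n × Fin n := ((p a, p b), p (third a b))

/-- The multi-index with prescribed entries in the factors `a`, `b` and in the remaining one. -/
def joinIdx (a b : Fin 3) (i j k : Fin n) : Fin 3 → Fin n :=
  fun t => if t = a then i else if t = b then j else k

theorem splitIdx_joinIdx {a b : Fin 3} (h : a ≠ b) (i j k : Fin n) :
    splitIdx a b (joinIdx a b i j k) = ((i, j), k) := by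
  have h1 := third_ne_left h
  have h2 := third_ne_right h
  simp [splitIdx, joinIdx, h1, h2, h.symm]

theorem splitIdx_injective {a b : Fin 3} (h : a ≠ b) :
    Function.Injective (splitIdx (n := n) a b) := by
  intro p r hpr
  simp only [splitIdx, Prod.mk.injEq] at hpr
  funext t
  rcases eq_or_eq_or_eq_third h t with rfl | rfl | rfl
  exacts [hpr.1.1, hpr.1.2, hpr.2]

theorem splitIdx_bijective {a b : Fin 3} (h : a ≠ b) :
    Function.Bijective (splitIdx (n := n) a b) :=
  ⟨splitIdx_injective h, fun ⟨⟨i, j⟩, k⟩ => ⟨joinIdx a b i j k, splitIdx_joinIdx h i j k⟩⟩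

/-- A two-factor matrix placed in the tensor factors `a` and `b`. -/
def emb (a b : Fin 3) (M : Matrix (Idx n) (Idx n) A) :
    Matrix (Fin 3 → Fin n) (Fin 3 → Fin n) A :=
  (Matrix.blockDiagonal fun _ : Fin n => M).submatrix (splitIdx a b) (splitIdx a b)

/-- A one-factor matrix placed in the tensor factor `a`. -/
def site (a : Fin 3) (X : Matrix (Fin n) (Fin n) A) :
    Matrix (Fin 3 → Fin n) (Fin 3 → Fin n) A :=
  fun p r => if p (a + 1) = r (a + 1) ∧ p (a + 2) = r (a + 2) then X (p a) (r a) else 0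

theorem emb_apply (a b : Fin 3) (M : Matrix (Idx n) (Idx n) A) (p r : Fin 3 → Fin n) :
    emb a b M p r =
      if p (third a b) = r (third a b) then M (p a, p b) (r a, r b) else 0 :=
  Matrix.blockDiagonal_apply (fun _ : Fin n => M) (splitIdx a b p) (splitIdx a b r)

theorem emb_mul {a b : Fin 3} (h : a ≠ b) (M N : Matrix (Idx n) (Idx n) A) :
    emb a b (M * N) = emb a b M * emb a b N := by
  rw [emb, Matrix.blockDiagonal_mul, Matrix.submatrix_mul _ _ _ _ _ (splitIdx_bijective h)]
  rfl

theorem emb_one {a b : Fin 3} (h : a ≠ b) : emb a b (1 : Matrix (Idx n) (Idx n) A) = 1 := by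
  have := Matrix.blockDiagonal_one (m := Idx n) (o := Fin n) (α := A)
  rw [emb, ← Matrix.submatrix_one _ (splitIdx_injective h), ← this]
  rfl

theorem emb_add (a b : Fin 3) (M N : Matrix (Idx n) (Idx n) A) :
    emb a b (M + N) = emb a b M + emb a b N := by
  ext p r
  simp only [emb_apply, Matrix.add_apply]
  split_ifs <;> simp

theorem emb_sub (a b : Fin 3) (M N : Matrix (Idx n) (Idx n) A) :
    emb a b (M - N) = emb a b M - emb a b N := by
  ext p r
  simp only [emb_apply, Matrix.sub_apply]
  split_ifs <;> simp

theorem emb_m1 {a b : Fin 3} (h : a ≠ b) (X : Matrix (Fin n) (Fin n) A) :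
    emb a b (m1 n A X) = site a X := by
  ext p r
  simp only [emb_apply, m1, site, ← ite_and]
  rcases eq_add_one_or_eq_add_two h with ⟨h1, h2⟩ | ⟨h1, h2⟩ <;>
    simp only [h2] <;> simp only [h1, and_comm]

theorem emb_submatrix_swap (a b : Fin 3) (M : Matrix (Idx n) (Idx n) A) :
    emb a b (M.submatrix Prod.swap Prod.swap) = emb b a M := by
  ext p r
  simp [emb_apply, third_comm b a]

theorem emb_m2 {a b : Fin 3} (h : a ≠ b) (X : Matrix (Fin n) (Fin n) A) :
    emb a b (m2 n A X) = site b X := by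
  rw [← emb_m1 h.symm, ← emb_submatrix_swap]
  rfl

/-- Permutation of the tensor factors. -/
def permFactors (σ : Equiv.Perm (Fin 3)) (N : Matrix (Fin 3 → Fin n) (Fin 3 → Fin n) A) :
    Matrix (Fin 3 → Fin n) (Fin 3 → Fin n) A :=
  N.submatrix (fun p => p ∘ σ) (fun p => p ∘ σ)

theorem permFactors_mul (σ : Equiv.Perm (Fin 3))
    (M N : Matrix (Fin 3 → Fin n) (Fin 3 → Fin n) A) :
    permFactors σ (M * N) = permFactors σ M * permFactors σ N :=
  Matrix.submatrix_mul _ _ _ _ _ (σ.arrowCongr (Equiv.refl (Fin n))).symm.bijective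

theorem permFactors_emb (σ : Equiv.Perm (Fin 3)) {a b : Fin 3} (h : a ≠ b)
    (M : Matrix (Idx n) (Idx n) A) : permFactors σ (emb a b M) = emb (σ a) (σ b) M := by
  ext p r
  simp [permFactors, emb_apply, map_third σ h]

theorem permFactors_site (σ : Equiv.Perm (Fin 3)) (a : Fin 3) (X : Matrix (Fin n) (Fin n) A) :
    permFactors σ (site a X) = site (σ a) X := by
  have h : a ≠ a + 1 := by revert a; decide
  rw [← emb_m1 h, permFactors_emb σ h, emb_m1 (σ.injective.ne h)]

theorem emb_Om_apply {a b : Fin 3} (h : a ≠ b) (p r : Fin 3 → Fin n) :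
    emb a b (Om n A) p r = if p ∘ Equiv.swap a b = r then 1 else 0 := by
  simp only [emb_apply, Om, ← ite_and]
  congr 1
  rw [← (splitIdx_injective h).eq_iff]
  have h1 := third_ne_left h
  have h2 := third_ne_right h
  simp [splitIdx, Equiv.swap_apply_of_ne_of_ne h1 h2]
  tauto

theorem emb_Om_mul {a b : Fin 3} (h : a ≠ b) (N : Matrix (Fin 3 → Fin n) (Fin 3 → Fin n) A) :
    emb a b (Om n A) * N = permFactors (Equiv.swap a b) N * emb a b (Om n A) := by
  ext p r
  have hs : ∀ t r : Fin 3 → Fin n, t ∘ Equiv.swap a b = r ↔ t = r ∘ Equiv.swap a b := by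
    intro t r
    constructor <;> rintro rfl <;> funext x <;> simp
  have hr : (r ∘ Equiv.swap a b) ∘ Equiv.swap a b = r := ((hs _ _).2 rfl)
  simp only [Matrix.mul_apply, emb_Om_apply h, ite_mul, one_mul, zero_mul, mul_ite, mul_one,
    mul_zero, Finset.sum_ite_eq, Finset.mem_univ, if_true]
  simp only [hs, Finset.sum_ite_eq', Finset.mem_univ, if_true, permFactors,
    Matrix.submatrix_apply, hr]

variable [Algebra K A]

theorem emb_smul (a b : Fin 3) (c : K) (M : Matrix (Idx n) (Idx n) A) :
    emb a b (c • M) = c • emb a b M := by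
  ext p r
  simp only [emb_apply, Matrix.smul_apply]
  split_ifs <;> simp

theorem ext_mul (M N : Matrix (Idx n) (Idx n) K) :
    ext n A (M * N) = ext n A M * ext n A N :=
  Matrix.map_mul (f := algebraMap K A)

theorem ext_one : ext n A (1 : Matrix (Idx n) (Idx n) K) = 1 :=
  Matrix.map_one _ (map_zero _) (map_one _)

theorem emb_ext (a b : Fin 3) (M : Matrix (Idx n) (Idx n) K) :
    emb a b (ext n A M) = (emb a b M).map (algebraMap K A) := by
  ext p r
  simp only [emb_apply, ext, Matrix.map_apply]
  split_ifs <;> simp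

theorem emb_ext_comm_site {a b c : Fin 3} (hab : a ≠ b) (hca : c ≠ a) (hcb : c ≠ b)
    (M : Matrix (Idx n) (Idx n) K) (X : Matrix (Fin n) (Fin n) A) :
    emb a b (ext n A M) * site c X = site c X * emb a b (ext n A M) := by
  obtain rfl : c = third a b := by
    have := eq_or_eq_or_eq_third hab c
    tauto
  have hX : site (third a b) X = (Matrix.of fun s t : Idx n × Fin n =>
      if s.1 = t.1 then X s.2 t.2 else 0).submatrix (splitIdx a b) (splitIdx a b) := by
    ext p r
    simp only [site, Matrix.submatrix_apply, Matrix.of_apply, splitIdx, Prod.mk.injEq]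
    rcases eq_add_one_or_eq_add_two hca with ⟨h1, h2⟩ | ⟨h1, h2⟩ <;>
      simp only [third_left] at h1 h2 <;> simp only [← h1, ← h2, and_comm]
  rw [hX, emb, ← Matrix.submatrix_mul _ _ _ _ _ (splitIdx_bijective hab),
    ← Matrix.submatrix_mul _ _ _ _ _ (splitIdx_bijective hab)]
  congr 1
  ext ⟨s, k⟩ ⟨t, l⟩
  simp only [Matrix.mul_apply, Matrix.blockDiagonal_apply, Matrix.of_apply, ite_mul, mul_ite,
    zero_mul, mul_zero, ext, Matrix.map_apply]
  rw [Fintype.sum_prod_type, eq_comm, Fintype.sum_prod_type_right]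
  simp [Algebra.commutes]

end Embedding

section RMatrix

variable {n : ℕ}

theorem qq_ne_zero : qq ≠ 0 := RatFunc.X_ne_zero

theorem Rm_apply (p r : Idx n) :
    Rm n p r = (if p = r then if p.1 = p.2 then qq else 1 else 0) +
      if p.swap = r then if p.1 < p.2 then qq - qq⁻¹ else 0 else 0 := by
  obtain ⟨i, j⟩ := p
  obtain ⟨k, l⟩ := r
  simp only [Rm, Prod.mk.injEq, Prod.swap_prod_mk]
  split_ifs <;> grind

theorem Rm21_eq : Rm21 n = (Rm n).submatrix Prod.swap Prod.swap := rfl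

theorem Rm_mul_apply {ι : Type*} (N : Matrix (Idx n) ι K) (p : Idx n) (r : ι) :
    (Rm n * N) p r = (if p.1 = p.2 then qq else 1) * N p r +
      (if p.1 < p.2 then qq - qq⁻¹ else 0) * N p.swap r := by
  simp only [Matrix.mul_apply, Rm_apply, add_mul, Finset.sum_add_distrib, ite_mul, zero_mul,
    Finset.sum_ite_eq, Finset.mem_univ, if_true]

theorem Rm_mul_inv : Rm n * (Rm21 n - (qq - qq⁻¹) • Om n K) = 1 := by
  have hq := qq_ne_zero
  ext ⟨i, j⟩ ⟨k, l⟩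
  simp only [Rm_mul_apply, Matrix.sub_apply, Matrix.smul_apply, Rm21_eq, Matrix.submatrix_apply,
    Rm_apply, Om, Prod.swap_prod_mk, Matrix.one_apply, Prod.mk.injEq, smul_eq_mul]
  rcases lt_trichotomy i j with h | rfl | h
  · simp [h, h.ne, h.ne', h.not_gt, and_comm]
  · simp only [and_comm (a := i = l), lt_irrefl, if_true, if_false]
    split_ifs <;> grind
  · simp [h, h.ne, h.ne', h.not_gt, and_comm]

theorem Rm_inv : (Rm n)⁻¹ = Rm21 n - (qq - qq⁻¹) • Om n K :=
  Matrix.inv_eq_right_inv Rm_mul_inv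

theorem isUnit_det_Rm : IsUnit (Rm n).det :=
  Matrix.isUnit_det_of_right_inverse Rm_mul_inv

theorem Rm21_inv : (Rm21 n)⁻¹ = (Rm n)⁻¹.submatrix Prod.swap Prod.swap :=
  (Matrix.inv_submatrix_equiv (Rm n) (Equiv.prodComm _ _) (Equiv.prodComm _ _))

theorem emb_Rm_apply {a b : Fin 3} (h : a ≠ b) (p r : Fin 3 → Fin n) :
    emb a b (Rm n) p r = (if p = r then if p a = p b then qq else 1 else 0) +
      if p ∘ Equiv.swap a b = r then if p a < p b then qq - qq⁻¹ else 0 else 0 := by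
  have h1 := third_ne_left h
  have h2 := third_ne_right h
  simp only [emb_apply, Rm_apply, ← (splitIdx_injective (n := n) h).eq_iff]
  simp only [splitIdx, Prod.mk.injEq, Prod.swap_prod_mk, Function.comp,
    Equiv.swap_apply_of_ne_of_ne h1 h2, Equiv.swap_apply_left, Equiv.swap_apply_right]
  split_ifs <;> grind

theorem emb_Rm_mul_apply {ι : Type*} {a b : Fin 3} (h : a ≠ b)
    (N : Matrix (Fin 3 → Fin n) ι K) (p : Fin 3 → Fin n) (r : ι) :
    (emb a b (Rm n) * N) p r = (if p a = p b then qq else 1) * N p r +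
      (if p a < p b then qq - qq⁻¹ else 0) * N (p ∘ Equiv.swap a b) r := by
  simp only [Matrix.mul_apply, emb_Rm_apply h, add_mul, Finset.sum_add_distrib, ite_mul, zero_mul,
    Finset.sum_ite_eq, Finset.mem_univ, if_true]

theorem emb_Rm_yangBaxter_zero_one_two :
    emb 0 1 (Rm n) * (emb 0 2 (Rm n) * emb 1 2 (Rm n)) =
      emb 1 2 (Rm n) * (emb 0 2 (Rm n) * emb 0 1 (Rm n)) := by
  have hq := qq_ne_zero
  have h01 : (0 : Fin 3) ≠ 1 := by decide
  have h02 : (0 : Fin 3) ≠ 2 := by decide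
  have h12 : (1 : Fin 3) ≠ 2 := by decide
  have e01 (i j k : Fin n) : ![i, j, k] ∘ Equiv.swap 0 1 = ![j, i, k] := by
    funext t; fin_cases t <;> rfl
  have e02 (i j k : Fin n) : ![i, j, k] ∘ Equiv.swap 0 2 = ![k, j, i] := by
    funext t; fin_cases t <;> rfl
  have e12 (i j k : Fin n) : ![i, j, k] ∘ Equiv.swap 1 2 = ![i, k, j] := by
    funext t; fin_cases t <;> rfl
  ext p r
  obtain ⟨i, j, k, rfl⟩ : ∃ i j k, p = ![i, j, k] :=
    ⟨p 0, p 1, p 2, by funext t; fin_cases t <;> rfl⟩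
  rw [← Matrix.mul_one (emb 1 2 (Rm n)), ← Matrix.mul_one (emb 0 1 (Rm n))]
  simp only [Matrix.mul_assoc, Matrix.one_mul]
  simp only [emb_Rm_mul_apply h01, emb_Rm_mul_apply h02, emb_Rm_mul_apply h12, e01, e02, e12]
  generalize (1 : Matrix (Fin 3 → Fin n) (Fin 3 → Fin n) K) = N
  simp only [Matrix.cons_val_zero, Matrix.cons_val_one, Matrix.cons_val]
  have cases_lt (i j : Fin n) : i < j ∧ i ≠ j ∧ j ≠ i ∧ ¬ j < i ∨ i = j ∨
      j < i ∧ i ≠ j ∧ j ≠ i ∧ ¬ i < j := by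
    omega
  rcases cases_lt i j with ⟨_, _, _, _⟩ | _ | ⟨_, _, _, _⟩ <;>
    rcases cases_lt j k with ⟨_, _, _, _⟩ | _ | ⟨_, _, _, _⟩ <;>
    rcases cases_lt i k with ⟨_, _, _, _⟩ | _ | ⟨_, _, _, _⟩ <;>
    first
    | (exfalso; omega)
    | (simp [*]; done)
    | (simp [*]; ring1)
    | (simp [*]; field_simp; ring1)

end RMatrix

section Families

variable {n : ℕ} {A : Type} [Ring A] [Algebra K A]

theorem emb_Rm_yangBaxter {a b c : Fin 3} (hab : a ≠ b) (hac : a ≠ c) (hbc : b ≠ c) :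
    emb a b (Rm n) * (emb a c (Rm n) * emb b c (Rm n)) =
      emb b c (Rm n) * (emb a c (Rm n) * emb a b (Rm n)) := by
  obtain ⟨σ, rfl, rfl, rfl⟩ : ∃ σ : Equiv.Perm (Fin 3), σ 0 = a ∧ σ 1 = b ∧ σ 2 = c := by
    revert hab hac hbc; revert a b c; decide
  have h := congrArg (permFactors σ) (emb_Rm_yangBaxter_zero_one_two (n := n))
  simpa only [permFactors_mul, permFactors_emb σ (show (0 : Fin 3) ≠ 1 by decide),
    permFactors_emb σ (show (0 : Fin 3) ≠ 2 by decide),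
    permFactors_emb σ (show (1 : Fin 3) ≠ 2 by decide)] using h

theorem isHeckeFamily_emb : IsHeckeFamily (qq - qq⁻¹)
    (fun a b => emb a b (ext n A (Rm n))) (fun a b => emb a b (ext n A (Rm n)⁻¹))
    (fun a b => emb a b (Om n A)) where
  R_mul_Q a b h := by
    rw [← emb_mul h, ← ext_mul, Matrix.mul_nonsing_inv _ isUnit_det_Rm, ext_one, emb_one h]
  Q_mul_R a b h := by
    rw [← emb_mul h, ← ext_mul, Matrix.nonsing_inv_mul _ isUnit_det_Rm, ext_one, emb_one h]
  yangBaxter a b c hab hac hbc := by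
    have h := congrArg (fun N => N.map (algebraMap K A))
      (emb_Rm_yangBaxter (n := n) hab hac hbc)
    simpa only [Matrix.map_mul, ← emb_ext, ← mul_assoc] using h
  hecke a b h := by
    rw [Rm_inv, Rm21_eq, ← emb_submatrix_swap b a (ext n A (Rm n)), ← emb_submatrix_swap b a
      (Om n A), ← emb_smul, ← emb_add]
    congr 1
    ext p r
    simp only [ext, Om, Matrix.map_apply, Matrix.sub_apply, Matrix.add_apply, Matrix.smul_apply,
      Matrix.submatrix_apply, Prod.fst_swap, Prod.snd_swap, and_comm (a := p.2 = r.1)]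
    split_ifs <;> simp [Algebra.smul_def]
  P_comm a b _ := by
    rw [← emb_submatrix_swap a b]
    congr 1
    ext p r
    simp [Om, and_comm]
  P_mul_R a b c d hab hcd := by rw [emb_Om_mul hab, permFactors_emb _ hcd]
  P_mul_Q a b c d hab hcd := by rw [emb_Om_mul hab, permFactors_emb _ hcd]
  P_mul_P a b c d hab hcd := by rw [emb_Om_mul hab, permFactors_emb _ hcd]

theorem isSiteFamily_site (X : Matrix (Fin n) (Fin n) A) : IsSiteFamily
    (fun a b => emb a b (ext n A (Rm n))) (fun a b => emb a b (ext n A (Rm n)⁻¹))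
    (fun a b => emb a b (Om n A)) (fun a => site a X) where
  comm_R _ _ _ hab hac hbc := emb_ext_comm_site hbc hab hac _ _
  comm_Q _ _ _ hab hac hbc := emb_ext_comm_site hbc hab hac _ _
  P_mul a b c hab := by rw [emb_Om_mul hab, permFactors_site]

theorem emb_ext_Rm21 (a b : Fin 3) : emb a b (ext n A (Rm21 n)) = emb b a (ext n A (Rm n)) := by
  rw [← emb_submatrix_swap]
  rfl

theorem emb_ext_Rm21_inv (a b : Fin 3) :
    emb a b (ext n A (Rm21 n)⁻¹) = emb b a (ext n A (Rm n)⁻¹) := by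
  rw [Rm21_inv, ← emb_submatrix_swap]
  rfl

/-- The defining relation of the quantum space generated by the entries of `X`. -/
def relX (X : Matrix (Fin n) (Fin n) A) : Matrix (Idx n) (Idx n) A :=
  ext n A (Rm21 n) * m1 n A X * ext n A (Rm n) * m2 n A X -
    m2 n A X * ext n A (Rm21 n) * m1 n A X * ext n A (Rm n)

/-- The defining relation of the quantum space generated by the entries of `D`. -/
def relD (D : Matrix (Fin n) (Fin n) A) : Matrix (Idx n) (Idx n) A :=
  ext n A (Rm n)⁻¹ * m1 n A D * ext n A (Rm21 n)⁻¹ * m2 n A D -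
    m2 n A D * ext n A (Rm n)⁻¹ * m1 n A D * ext n A (Rm21 n)⁻¹

/-- The exchange relation between `D` and `X`. -/
def relDX (X D : Matrix (Fin n) (Fin n) A) : Matrix (Idx n) (Idx n) A :=
  m1 n A D * ext n A (Rm21 n)⁻¹ * m2 n A X * ext n A (Rm21 n) -
    ext n A (Rm n) * m2 n A X * ext n A (Rm21 n) * m1 n A D -
      (qq - qq⁻¹) • (ext n A (Rm n) * Om n A)

/-- The relation between `D` and `X`, solved for `X₂R₂₁D₁`. -/
theorem site_mul_emb_mul_site {X D : Matrix (Fin n) (Fin n) A} (hDX : relDX X D = 0)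
    (a b : Fin 3) (hab : a ≠ b) :
    site b X * emb b a (ext n A (Rm n)) * site a D =
      emb a b (ext n A (Rm n)⁻¹) * site a D * emb b a (ext n A (Rm n)⁻¹) * site b X *
        emb b a (ext n A (Rm n)) - (qq - qq⁻¹) • emb a b (Om n A) := by
  have hH := isHeckeFamily_emb (n := n) (A := A)
  have h := congrArg (emb a b) hDX
  have h0 : emb a b (0 : Matrix (Idx n) (Idx n) A) = 0 := by
    ext p r
    simp [emb_apply]
  simp only [relDX, emb_sub, emb_smul, emb_mul hab, emb_m1 hab, emb_m2 hab, emb_ext_Rm21,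
    emb_ext_Rm21_inv, h0] at h
  rw [sub_right_comm, sub_eq_zero] at h
  have h' := congrArg (emb a b (ext n A (Rm n)⁻¹) * ·) h
  have h1 := hH.Q_R_cancel hab
  beta_reduce at h1
  simpa only [mul_sub, mul_smul_comm, mul_assoc, h1] using h'.symm

end Families

section SkewInverse

variable {n : ℕ}

theorem sum_Rm_smul_of_ne {M : Type*} [AddCommGroup M] [Module K M] (v : Fin n → Fin n → M)
    {b c : Fin n} (h : b ≠ c) : ∑ i, ∑ j, Rm n (i, b) (c, j) • v j i = v b c := by
  simp [Rm_apply, ite_smul, h, h.symm, ite_and]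

theorem sum_Rm_smul_self {M : Type*} [AddCommGroup M] [Module K M] (v : Fin n → Fin n → M)
    (b : Fin n) : ∑ i, ∑ j, Rm n (i, b) (b, j) • v j i =
      qq • v b b + ∑ i, if i < b then (qq - qq⁻¹) • v i i else 0 := by
  simp [Rm_apply, add_smul, ite_smul, Finset.sum_add_distrib, ite_and]

/-- The `R`-matrix with one factor transposed is invertible. -/
theorem mem_of_sum_Rm_smul_mem {M : Type*} [AddCommGroup M] [Module K M] (U : Submodule K M)
    (v : Fin n → Fin n → M) (h : ∀ b c, ∑ i, ∑ j, Rm n (i, b) (c, j) • v j i ∈ U)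
    (b c : Fin n) : v b c ∈ U := by
  rcases eq_or_ne b c with rfl | hbc
  · induction b using WellFoundedLT.induction with
    | ind b ih =>
      have hb := h b b
      rw [sum_Rm_smul_self, add_comm, U.add_mem_iff_right, U.smul_mem_iff qq_ne_zero] at hb
      · exact hb
      · refine U.sum_mem fun i _ => ?_
        split_ifs with hi
        exacts [U.smul_mem _ (ih i hi), U.zero_mem]
  · rw [← sum_Rm_smul_of_ne v hbc]
    exact h b c

end SkewInverse

section Entries

variable {n : ℕ} {A : Type} [Ring A]

theorem emb_mul_apply {a b : Fin 3} (h : a ≠ b) (M : Matrix (Idx n) (Idx n) A)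
    (N : Matrix (Fin 3 → Fin n) (Fin 3 → Fin n) A) (p r : Fin 3 → Fin n) :
    (emb a b M * N) p r =
      ∑ i, ∑ j, M (p a, p b) (i, j) * N (joinIdx a b i j (p (third a b))) r := by
  let e := Equiv.ofBijective _ (splitIdx_bijective (n := n) h)
  have he : ∀ i j k, e.symm ((i, j), k) = joinIdx a b i j k := fun i j k => by
    rw [Equiv.symm_apply_eq]
    exact (splitIdx_joinIdx h i j k).symm
  rw [Matrix.mul_apply, ← e.symm.sum_comp, Fintype.sum_prod_type, Fintype.sum_prod_type]
  refine Finset.sum_congr rfl fun i _ => Finset.sum_congr rfl fun j _ => ?_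
  have hs := fun k => splitIdx_joinIdx (n := n) h i j k
  simp only [splitIdx, Prod.mk.injEq] at hs
  simp [he, emb_apply, hs]

theorem site_mul_apply (a : Fin 3) (X : Matrix (Fin n) (Fin n) A)
    (N : Matrix (Fin 3 → Fin n) (Fin 3 → Fin n) A) (p r : Fin 3 → Fin n) :
    (site a X * N) p r = ∑ i, X (p a) i * N (Function.update p a i) r := by
  have h : a ≠ a + 1 := by revert a; decide
  rw [← emb_m1 h, emb_mul_apply h]
  refine Finset.sum_congr rfl fun i _ => ?_
  have : joinIdx a (a + 1) i (p (a + 1)) (p (third a (a + 1))) = Function.update p a i := by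
    funext t
    rcases eq_or_eq_or_eq_third h t with rfl | rfl | rfl
    · simp [joinIdx]
    · simp [joinIdx, h.symm]
    · simp [joinIdx, third_ne_left h, third_ne_right h]
  simp [m1, this]

variable [Algebra K A]

theorem mul_entry_mem {ι κ μ : Type*} [Fintype κ] {U V : Submodule K A} {M : Matrix ι κ A}
    {N : Matrix κ μ A} (hM : ∀ p r, M p r ∈ U) (hN : ∀ p r, N p r ∈ V) (p : ι) (r : μ) :
    (M * N) p r ∈ U * V :=
  Submodule.sum_mem _ fun _ _ => Submodule.mul_mem_mul (hM _ _) (hN _ _)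

theorem emb_entry_mem {U : Submodule K A} {M : Matrix (Idx n) (Idx n) A}
    (hM : ∀ p r, M p r ∈ U) (a b : Fin 3) (p r : Fin 3 → Fin n) : emb a b M p r ∈ U := by
  rw [emb_apply]
  split_ifs
  exacts [hM _ _, U.zero_mem]

theorem emb_ext_entry_mem (M : Matrix (Idx n) (Idx n) K) (a b : Fin 3) (p r : Fin 3 → Fin n) :
    emb a b (ext n A M) p r ∈ (1 : Submodule K A) :=
  emb_entry_mem (fun _ _ => Submodule.mem_one.2 ⟨_, rfl⟩) a b p r

theorem site_entry_mem {U : Submodule K A} {X : Matrix (Fin n) (Fin n) A}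
    (hX : ∀ i j, X i j ∈ U) (a : Fin 3) (p r : Fin 3 → Fin n) : site a X p r ∈ U := by
  rw [site]
  split_ifs
  exacts [hX _ _, U.zero_mem]

theorem joinIdx_one_zero (i j a b c : Fin n) :
    joinIdx 1 0 i j (![a, b, c] (third 1 0)) = ![j, i, c] := by
  funext t; fin_cases t <;> rfl

theorem joinIdx_two_one (i j a b c : Fin n) :
    joinIdx 2 1 i j (![a, b, c] (third 2 1)) = ![a, j, i] := by
  funext t; fin_cases t <;> rfl

theorem joinIdx_two_zero (i j a b c : Fin n) :
    joinIdx 2 0 i j (![a, b, c] (third 2 0)) = ![j, b, i] := by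
  funext t; fin_cases t <;> rfl

theorem joinIdx_zero_one (i j a b c : Fin n) :
    joinIdx 0 1 i j (![a, b, c] (third 0 1)) = ![i, j, c] := by
  funext t; fin_cases t <;> rfl

theorem joinIdx_zero_two (i j a b c : Fin n) :
    joinIdx 0 2 i j (![a, b, c] (third 0 2)) = ![i, b, j] := by
  funext t; fin_cases t <;> rfl

theorem joinIdx_one_two (i j a b c : Fin n) :
    joinIdx 1 2 i j (![a, b, c] (third 1 2)) = ![a, i, j] := by
  funext t; fin_cases t <;> rfl

theorem update_one (i a b c : Fin n) : Function.update ![a, b, c] 1 i = ![a, i, c] := by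
  funext t; fin_cases t <;> rfl

theorem update_two (i a b c : Fin n) : Function.update ![a, b, c] 2 i = ![a, b, i] := by
  funext t; fin_cases t <;> rfl

theorem mul_mem_of_site_mul_emb_mul_site_mem (U : Submodule K A) {X D : Matrix (Fin n) (Fin n) A}
    (h : ∀ p r, (site 1 X * (emb 1 0 (ext n A (Rm n)) * site 0 D)) p r ∈ U) (i j k l : Fin n) :
    X i j * D k l ∈ U := by
  refine mem_of_sum_Rm_smul_mem U (fun k j => X i j * D k l) (fun b c => ?_) k j
  have hp := h ![b, i, i] ![l, c, i]
  simp only [site_mul_apply, emb_mul_apply (show (1 : Fin 3) ≠ 0 by decide), update_one,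
    joinIdx_one_zero] at hp
  convert hp using 1
  refine Finset.sum_congr rfl fun d _ => ?_
  simp [site, Finset.mul_sum, ext, Algebra.smul_def, Algebra.left_comm]

theorem mul_mem_of_site_mul_emb_mem (U : Submodule K A) {X : Matrix (Fin n) (Fin n) A}
    {E : Matrix (Idx n) (Idx n) A}
    (h : ∀ p r, (site 2 X * (emb 2 1 (ext n A (Rm n)) * (emb 2 0 (ext n A (Rm n)) * emb 0 1 E)))
      p r ∈ U) (i j : Fin n) (p r : Idx n) :
    X i j * E p r ∈ U := by
  obtain ⟨p₁, p₂⟩ := p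
  refine mem_of_sum_Rm_smul_mem U (fun p₂ j => X i j * E (p₁, p₂) r) (fun b d => ?_) p₂ j
  refine mem_of_sum_Rm_smul_mem U (fun p₁ d => ∑ k, ∑ l, Rm n (k, b) (d, l) •
    (X i k * E (p₁, l) r)) (fun a c => ?_) p₁ d
  have hp := h ![a, b, i] ![r.1, r.2, c]
  simp only [site_mul_apply, emb_mul_apply (show (2 : Fin 3) ≠ 1 by decide),
    emb_mul_apply (show (2 : Fin 3) ≠ 0 by decide), update_two, joinIdx_two_one,
    joinIdx_two_zero] at hp
  convert hp using 1
  have hE (x y z : Fin n) : emb 0 1 E ![x, y, z] ![r.1, r.2, c] =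
      if z = c then E (x, y) r else 0 := emb_apply ..
  simp only [hE, mul_ite, mul_zero]
  rw [Finset.sum_congr rfl fun d _ => Finset.sum_congr rfl fun a₁ _ => Finset.smul_sum,
    Finset.sum_congr rfl fun d _ => Finset.sum_comm, Finset.sum_comm]
  refine Finset.sum_congr rfl fun x _ => ?_
  rw [Finset.mul_sum]
  refine Finset.sum_congr rfl fun d _ => ?_
  rw [Finset.sum_congr rfl fun a₁ _ => Finset.smul_sum, Finset.sum_comm, Finset.mul_sum]
  refine Finset.sum_congr rfl fun l _ => ?_
  rw [Finset.sum_comm, Finset.mul_sum, Finset.mul_sum]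
  refine Finset.sum_congr rfl fun a₁ _ => ?_
  simp [ext, ← Algebra.smul_def]

theorem mul_mem_of_emb_mul_site_mem (U : Submodule K A) {D : Matrix (Fin n) (Fin n) A}
    {E : Matrix (Idx n) (Idx n) A}
    (h : ∀ p r, (emb 0 1 E * (emb 0 2 (ext n A (Rm n)) * (emb 1 2 (ext n A (Rm n)) * site 2 D)))
      p r ∈ U) (p r : Idx n) (k l : Fin n) :
    E p r * D k l ∈ U := by
  obtain ⟨i, j⟩ := r
  refine mem_of_sum_Rm_smul_mem U (fun k j => E p (i, j) * D k l) (fun c b => ?_) k j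
  refine mem_of_sum_Rm_smul_mem U (fun c i => ∑ j, ∑ k, Rm n (j, c) (b, k) •
    (E p (i, j) * D k l)) (fun d a => ?_) c i
  have hp := h ![p.1, p.2, d] ![a, b, l]
  simp only [emb_mul_apply (show (0 : Fin 3) ≠ 1 by decide),
    emb_mul_apply (show (0 : Fin 3) ≠ 2 by decide), emb_mul_apply (show (1 : Fin 3) ≠ 2 by decide),
    joinIdx_zero_one, joinIdx_zero_two, joinIdx_one_two] at hp
  convert hp using 1
  have hD (x y z : Fin n) : site 2 D ![x, y, z] ![a, b, l] =
      if x = a ∧ y = b then D z l else 0 := rfl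
  simp only [hD]
  refine Finset.sum_congr rfl fun i _ => ?_
  rw [Finset.sum_congr rfl fun k _ => Finset.smul_sum, Finset.sum_comm]
  refine Finset.sum_congr rfl fun j _ => ?_
  simp only [ext, Matrix.map_apply, ← Algebra.smul_def, Finset.mul_sum, Finset.smul_sum, ite_and,
    mul_ite, mul_zero, mul_smul_comm]
  simp [smul_comm (Rm n (i, d) _)]

end Entries

section Exchange

variable {n : ℕ} {A : Type} [Ring A] [Algebra K A]

/-- The set of entries of a matrix. -/
def entrySet {ι κ : Type*} (M : Matrix ι κ A) : Set A := Set.range fun p : ι × κ => M p.1 p.2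

/-- The span of the entries of a matrix. -/
def entries {ι κ : Type*} (M : Matrix ι κ A) : Submodule K A :=
  Submodule.span K (entrySet M)

theorem entry_mem_entries {ι κ : Type*} (M : Matrix ι κ A) (i : ι) (j : κ) :
    M i j ∈ entries M :=
  Submodule.subset_span ⟨(i, j), rfl⟩

theorem entries_mul_entries_le {ι κ μ ν : Type*} {M : Matrix ι κ A} {N : Matrix μ ν A}
    {U : Submodule K A} : entries M * entries N ≤ U ↔ ∀ i j k l, M i j * N k l ∈ U := by
  rw [entries, entries, Submodule.span_mul_span, Submodule.span_le, Set.mul_subset_iff]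
  simp only [entrySet, Set.forall_mem_range, Prod.forall, SetLike.mem_coe]

theorem emb_relX {a b : Fin 3} (h : a ≠ b) (X : Matrix (Fin n) (Fin n) A) :
    emb a b (relX X) =
      emb b a (ext n A (Rm n)) * site a X * emb a b (ext n A (Rm n)) * site b X -
        site b X * emb b a (ext n A (Rm n)) * site a X * emb a b (ext n A (Rm n)) := by
  simp only [relX, emb_sub, emb_mul h, emb_m1 h, emb_m2 h, emb_ext_Rm21]

theorem emb_relD {a b : Fin 3} (h : a ≠ b) (D : Matrix (Fin n) (Fin n) A) :
    emb a b (relD D) =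
      emb a b (ext n A (Rm n)⁻¹) * site a D * emb b a (ext n A (Rm n)⁻¹) * site b D -
        site b D * emb a b (ext n A (Rm n)⁻¹) * site a D * emb b a (ext n A (Rm n)⁻¹) := by
  simp only [relD, emb_sub, emb_mul h, emb_m1 h, emb_m2 h, emb_ext_Rm21_inv]

variable {X D : Matrix (Fin n) (Fin n) A}

theorem entries_mul_entries_le_of_relDX (h : relDX X D = 0) :
    entries X * entries D ≤ entries D * entries X ⊔ 1 := by
  have h01 : (0 : Fin 3) ≠ 1 := by decide
  refine entries_mul_entries_le.2 (mul_mem_of_site_mul_emb_mul_site_mem _ fun p r => ?_)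
  rw [← mul_assoc, site_mul_emb_mul_site h 0 1 h01]
  refine Submodule.sub_mem _ (Submodule.mem_sup_left ?_) (Submodule.mem_sup_right ?_)
  · have hQ := emb_ext_entry_mem (A := A) (Rm n)⁻¹
    have hR := emb_ext_entry_mem (A := A) (Rm n)
    simpa only [one_mul, mul_one] using
      mul_entry_mem (mul_entry_mem (mul_entry_mem (mul_entry_mem (hQ 0 1)
        (site_entry_mem (entry_mem_entries D) 0)) (hQ 1 0))
        (site_entry_mem (entry_mem_entries X) 1)) (hR 1 0) p r
  · refine Submodule.smul_mem _ _ (emb_entry_mem (fun p r => ?_) 0 1 p r)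
    rw [Om]
    split_ifs
    exacts [Submodule.mem_one.2 ⟨1, map_one _⟩, Submodule.zero_mem _]

theorem entries_mul_entries_relD_le (h : relDX X D = 0) :
    entries X * entries (relD D) ≤ entries (relD D) * entries X := by
  have h01 : (0 : Fin 3) ≠ 1 := by decide
  refine entries_mul_entries_le.2 fun i j p r =>
    mul_mem_of_site_mul_emb_mem _ (fun p r => ?_) i j p r
  have := x_move_relation (isHeckeFamily_emb (n := n) (A := A)) (isSiteFamily_site X)
    (isSiteFamily_site D) (site_mul_emb_mul_site h)
  simp only [← emb_relD h01] at this
  rw [this]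
  have hQ := emb_ext_entry_mem (A := A) (Rm n)⁻¹
  have hR := emb_ext_entry_mem (A := A) (Rm n)
  simpa only [one_mul, mul_one] using
    mul_entry_mem (hQ 1 2) (mul_entry_mem (hQ 0 2) (mul_entry_mem
      (emb_entry_mem (entry_mem_entries (relD D)) 0 1) (mul_entry_mem (hQ 2 0) (mul_entry_mem
      (hQ 2 1) (mul_entry_mem (site_entry_mem (entry_mem_entries X) 2)
      (mul_entry_mem (hR 2 1) (hR 2 0))))))) p r

theorem entries_relX_mul_entries_le (h : relDX X D = 0) :
    entries (relX X) * entries D ≤ entries D * entries (relX X) := by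
  have h01 : (0 : Fin 3) ≠ 1 := by decide
  refine entries_mul_entries_le.2 fun p r k l =>
    mul_mem_of_emb_mul_site_mem _ (fun p r => ?_) p r k l
  have := d_move_relation (isHeckeFamily_emb (n := n) (A := A)) (isSiteFamily_site X)
    (isSiteFamily_site D) (site_mul_emb_mul_site h)
  simp only [← emb_relX h01] at this
  rw [this]
  have hQ := emb_ext_entry_mem (A := A) (Rm n)⁻¹
  have hR := emb_ext_entry_mem (A := A) (Rm n)
  simpa only [one_mul, mul_one] using
    mul_entry_mem (hQ 2 0) (mul_entry_mem (hQ 2 1) (mul_entry_mem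
      (site_entry_mem (entry_mem_entries D) 2) (mul_entry_mem (hQ 1 2) (mul_entry_mem (hQ 0 2)
      (mul_entry_mem (emb_entry_mem (entry_mem_entries (relX X)) 0 1)
      (mul_entry_mem (hR 0 2) (hR 1 2))))))) p r

end Exchange

section Adjoin

variable {A : Type} [Ring A] [Algebra K A]

/-- The subalgebra generated by `s`, as a submodule. -/
def gen (s : Set A) : Submodule K A := (Algebra.adjoin K s).toSubmodule

theorem gen_mul_gen (s : Set A) : gen s * gen s = gen s :=
  (Algebra.adjoin K s).isIdempotentElem_toSubmodule

theorem one_le_gen (s : Set A) : 1 ≤ gen s := by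
  rw [Submodule.one_le]
  exact one_mem (Algebra.adjoin K s)

theorem span_le_gen (s : Set A) : Submodule.span K s ≤ gen s :=
  Algebra.span_le_adjoin K s

theorem gen_mul_le {s : Set A} {U : Submodule K A} (h : Submodule.span K s * U ≤ U * gen s) :
    gen s * U ≤ U * gen s := by
  have key : ∀ x ∈ Algebra.adjoin K s, ∀ w ∈ U * gen s, x * w ∈ U * gen s := by
    intro x hx
    induction hx using Algebra.adjoin_induction with
    | mem x hx =>
      intro w hw
      have := Submodule.mul_mem_mul (Submodule.subset_span (R := K) hx) hw
      rw [← mul_assoc] at this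
      have := mul_le_mul_left h _ this
      rwa [mul_assoc, gen_mul_gen] at this
    | algebraMap c =>
      intro w hw
      rw [← Algebra.smul_def]
      exact Submodule.smul_mem _ c hw
    | add x y _ _ hx hy =>
      intro w hw
      rw [add_mul]
      exact add_mem (hx w hw) (hy w hw)
    | mul x y _ _ hx hy =>
      intro w hw
      rw [mul_assoc]
      exact hx _ (hy w hw)
  refine Submodule.mul_le.2 fun x hx u hu => key x hx u ?_
  rw [← mul_one u]
  exact Submodule.mul_mem_mul hu (one_mem (Algebra.adjoin K s))

theorem mul_gen_le {s : Set A} {U : Submodule K A} (h : U * Submodule.span K s ≤ gen s * U) :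
    U * gen s ≤ gen s * U := by
  have key : ∀ x ∈ Algebra.adjoin K s, ∀ w ∈ gen s * U, w * x ∈ gen s * U := by
    intro x hx
    induction hx using Algebra.adjoin_induction with
    | mem x hx =>
      intro w hw
      have := Submodule.mul_mem_mul hw (Submodule.subset_span (R := K) hx)
      rw [mul_assoc] at this
      have := mul_le_mul_right h _ this
      rwa [← mul_assoc, gen_mul_gen] at this
    | algebraMap c =>
      intro w hw
      rw [← Algebra.commutes, ← Algebra.smul_def]
      exact Submodule.smul_mem _ c hw
    | add x y _ _ hx hy =>
      intro w hw
      rw [mul_add]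
      exact add_mem (hx w hw) (hy w hw)
    | mul x y _ _ hx hy =>
      intro w hw
      rw [← mul_assoc]
      exact hy _ (hx w hw)
  refine Submodule.mul_le.2 fun u hu x hx => key x hx u ?_
  rw [← one_mul u]
  exact Submodule.mul_mem_mul (one_mem (Algebra.adjoin K s)) hu

theorem gen_mul_ideal_le {s t : Set A} {E : Submodule K A}
    (hst : Submodule.span K s * Submodule.span K t ≤
      Submodule.span K t * Submodule.span K s ⊔ 1)
    (hE : Submodule.span K s * E ≤ E * Submodule.span K s) :
    gen s * (gen t * E * gen t) ≤ gen t * E * gen t * gen s := by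
  set V : Submodule K A := 1 ⊔ Submodule.span K s with hV
  have h1V : 1 ≤ V := le_sup_left
  have hsV : Submodule.span K s ≤ V := le_sup_right
  have hVs : V ≤ gen s := sup_le (one_le_gen s) (span_le_gen s)
  have hVt : V * gen t ≤ gen t * V := by
    refine mul_gen_le ?_
    rw [hV, Submodule.sup_mul, one_mul]
    refine sup_le ?_ (hst.trans (sup_le (mul_le_mul' (span_le_gen t) hsV) ?_))
    · simpa using mul_le_mul' (span_le_gen t) h1V
    · simpa using mul_le_mul' (one_le_gen t) h1V
  have hVE : V * E ≤ E * V := by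
    rw [hV, Submodule.sup_mul, Submodule.mul_sup, one_mul, mul_one]
    exact sup_le_sup_left hE _
  refine gen_mul_le ?_
  calc Submodule.span K s * (gen t * E * gen t)
      ≤ V * gen t * (E * gen t) := by
        rw [mul_assoc (gen t), ← mul_assoc]; gcongr
    _ ≤ gen t * V * (E * gen t) := by gcongr
    _ = gen t * (V * E) * gen t := by simp only [mul_assoc]
    _ ≤ gen t * (E * V) * gen t := by gcongr
    _ = gen t * E * (V * gen t) := by simp only [mul_assoc]
    _ ≤ gen t * E * (gen t * V) := by gcongr
    _ = gen t * E * gen t * V := by simp only [mul_assoc]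
    _ ≤ gen t * E * gen t * gen s := by gcongr

theorem ideal_mul_gen_le {s t : Set A} {E : Submodule K A}
    (hst : Submodule.span K s * Submodule.span K t ≤
      Submodule.span K t * Submodule.span K s ⊔ 1)
    (hE : E * Submodule.span K t ≤ Submodule.span K t * E) :
    gen s * E * gen s * gen t ≤ gen t * (gen s * E * gen s) := by
  set W : Submodule K A := 1 ⊔ Submodule.span K t with hW
  have h1W : 1 ≤ W := le_sup_left
  have htW : Submodule.span K t ≤ W := le_sup_right
  have hWt : W ≤ gen t := sup_le (one_le_gen t) (span_le_gen t)
  have hWs : gen s * W ≤ W * gen s := by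
    refine gen_mul_le ?_
    rw [hW, Submodule.mul_sup, mul_one]
    refine sup_le ?_ (hst.trans (sup_le (mul_le_mul' htW (span_le_gen s)) ?_))
    · simpa using mul_le_mul' h1W (span_le_gen s)
    · simpa using mul_le_mul' h1W (one_le_gen s)
  have hWE : E * W ≤ W * E := by
    rw [hW, Submodule.sup_mul, Submodule.mul_sup, one_mul, mul_one]
    exact sup_le_sup_left hE _
  refine mul_gen_le ?_
  calc gen s * E * gen s * Submodule.span K t
      ≤ gen s * E * (gen s * W) := by
        rw [mul_assoc (gen s * E)]; gcongr
    _ ≤ gen s * E * (W * gen s) := by gcongr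
    _ = gen s * (E * W) * gen s := by simp only [mul_assoc]
    _ ≤ gen s * (W * E) * gen s := by gcongr
    _ = gen s * W * (E * gen s) := by simp only [mul_assoc]
    _ ≤ W * gen s * (E * gen s) := by gcongr
    _ = W * (gen s * E * gen s) := by simp only [mul_assoc]
    _ ≤ gen t * (gen s * E * gen s) := by gcongr

theorem mul_eq_span (U V : Submodule K A) :
    U * V = Submodule.span K {z | ∃ u ∈ U, ∃ v ∈ V, z = u * v} := by
  rw [← Submodule.span_eq U, ← Submodule.span_eq V, Submodule.span_mul_span]
  congr 1
  ext z
  simp [Set.mem_mul, eq_comm]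

theorem span_mul_mul_eq (S : Subalgebra K A) (E : Set A) :
    Submodule.span K {y | ∃ a ∈ S, ∃ e ∈ E, ∃ b ∈ S, y = a * e * b} =
      S.toSubmodule * Submodule.span K E * S.toSubmodule := by
  rw [← Submodule.span_eq S.toSubmodule, Submodule.span_mul_span, Submodule.span_mul_span]
  congr 1
  ext y
  simp only [Set.mem_mul, SetLike.mem_coe, Subalgebra.mem_toSubmodule,
    exists_exists_and_exists_and_eq_and]
  grind

theorem map_gen {A' : Type} [Ring A'] [Algebra K A'] (f : A →ₐ[K] A') (s : Set A) :
    (gen s).map f.toLinearMap = gen (f '' s) := by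
  rw [gen, gen, ← AlgHom.map_adjoin, Subalgebra.map_toSubmodule]

end Adjoin

section Transfer

variable {n : ℕ} {A A' : Type} [Ring A] [Algebra K A] [Ring A'] [Algebra K A']

theorem image_entrySet (f : A →ₐ[K] A') {ι κ : Type*} (M : Matrix ι κ A) :
    f '' entrySet M = entrySet (M.map f) := by
  rw [entrySet, entrySet, ← Set.range_comp]
  rfl

theorem map_entries (f : A →ₐ[K] A') {ι κ : Type*} (M : Matrix ι κ A) :
    (entries M).map f.toLinearMap = entries (M.map f) := by
  rw [entries, entries, Submodule.map_span, ← image_entrySet]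
  rfl

theorem map_ext (f : A →ₐ[K] A') (M : Matrix (Idx n) (Idx n) K) :
    (ext n A M).map f = ext n A' M := by
  ext p r
  simp [ext]

theorem map_m1 (f : A →ₐ[K] A') (M : Matrix (Fin n) (Fin n) A) :
    (m1 n A M).map f = m1 n A' (M.map f) := by
  ext p r
  simp [m1, apply_ite f]

theorem map_m2 (f : A →ₐ[K] A') (M : Matrix (Fin n) (Fin n) A) :
    (m2 n A M).map f = m2 n A' (M.map f) := by
  ext p r
  simp [m2, apply_ite f]

theorem map_Om (f : A →ₐ[K] A') : (Om n A).map f = Om n A' := by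
  ext p r
  simp [Om, apply_ite f]

theorem map_relX (f : A →ₐ[K] A') (X : Matrix (Fin n) (Fin n) A) :
    (relX X).map f = relX (X.map f) := by
  simp only [relX, ← map_ext f, ← map_m1, ← map_m2, ← Matrix.map_mul]
  exact Matrix.map_sub f (map_sub f) _ _

theorem map_relD (f : A →ₐ[K] A') (D : Matrix (Fin n) (Fin n) A) :
    (relD D).map f = relD (D.map f) := by
  simp only [relD, ← map_ext f, ← map_m1, ← map_m2, ← Matrix.map_mul]
  exact Matrix.map_sub f (map_sub f) _ _

theorem map_relDX (f : A →ₐ[K] A') (X D : Matrix (Fin n) (Fin n) A) :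
    (relDX X D).map f = relDX (X.map f) (D.map f) := by
  simp only [relDX, ← map_ext f, ← map_m1, ← map_m2, ← map_Om f, ← Matrix.map_mul]
  rw [Matrix.map_sub f (map_sub f), Matrix.map_sub f (map_sub f),
    Matrix.map_smul f _ (map_smul f _)]

/-- `IDX n` as a two-sided ideal. -/
def idealDX (n : ℕ) : TwoSidedIdeal (T n) :=
  TwoSidedIdeal.mk' (IDX n) (zero_mem _) add_mem neg_mem
    (by
      intro x y hy
      refine Submodule.span_induction (p := fun y _ => x * y ∈ IDX n) ?_ ?_ ?_ ?_ hy
      · rintro _ ⟨a, e, he, b, rfl⟩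
        exact Submodule.subset_span ⟨x * a, e, he, b, by simp only [mul_assoc]⟩
      · simp
      · intro y z _ _ hy hz
        rw [mul_add]
        exact add_mem hy hz
      · intro c y _ hy
        rw [mul_smul_comm]
        exact Submodule.smul_mem _ c hy)
    (by
      intro y x hy
      refine Submodule.span_induction (p := fun y _ => y * x ∈ IDX n) ?_ ?_ ?_ ?_ hy
      · rintro _ ⟨a, e, he, b, rfl⟩
        exact Submodule.subset_span ⟨a, e, he, b * x, by simp only [mul_assoc]⟩
      · simp
      · intro y z _ _ hy hz
        rw [add_mul]
        exact add_mem hy hz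
      · intro c y _ hy
        rw [smul_mul_assoc]
        exact Submodule.smul_mem _ c hy)

/-- The quotient map `T → T / I_{DX}`. -/
def quotDX (n : ℕ) : T n →ₐ[K] (idealDX n).ringCon.Quotient := RingCon.mkₐ (α := K) _

theorem quotDX_eq_zero_iff {y : T n} : quotDX n y = 0 ↔ y ∈ IDX n := by
  have : quotDX n y = 0 ↔ y ∈ idealDX n := by
    rw [TwoSidedIdeal.mem_iff, ← RingCon.eq]
    rfl
  rw [this, idealDX, TwoSidedIdeal.mem_mk']
  rfl

theorem mem_sup_IDX {S : Submodule K (T n)} {y : T n}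
    (h : quotDX n y ∈ S.map (quotDX n).toLinearMap) : y ∈ S ⊔ IDX n := by
  obtain ⟨z, hz, hzy⟩ := h
  rw [← add_sub_cancel z y]
  refine Submodule.add_mem_sup hz (quotDX_eq_zero_iff.1 ?_)
  rw [map_sub, sub_eq_zero]
  exact hzy.symm

theorem relDX_quotDX : relDX ((xF n).map (quotDX n)) ((dF n).map (quotDX n)) = 0 := by
  rw [← map_relDX]
  ext p r
  refine quotDX_eq_zero_iff.2 (Submodule.subset_span ⟨1, _, ⟨p, r, rfl⟩, 1, ?_⟩)
  rw [one_mul, mul_one]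
  rfl

theorem ID_eq (n : ℕ) : ID n =
    gen (entrySet (dF n)) * entries (relD (dF n)) * gen (entrySet (dF n)) := by
  have : entD n = entrySet (relD (dF n)) := by
    ext y
    simp [entD, entrySet, relD, eq_comm]
  rw [ID, this]
  exact span_mul_mul_eq _ _

theorem IX_eq (n : ℕ) : IX n =
    gen (entrySet (xF n)) * entries (relX (xF n)) * gen (entrySet (xF n)) := by
  have : entX n = entrySet (relX (xF n)) := by
    ext y
    simp [entX, entrySet, relX, eq_comm]
  rw [IX, this]
  exact span_mul_mul_eq _ _

end Transfer

/--
With `I_X, I_D, I_{DX}` the two-sided ideals generated by the entries of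
the three defining relations of `D_1`, one has `T_X · I_D ⊆ I_D · T_X + I_{DX}` and
`I_X · T_D ⊆ T_D · I_X + I_{DX}` inside the free algebra `T`.
-/
theorem statement_14 (n : ℕ) (hn : 1 ≤ n) :
    (∀ u ∈ TXs n, ∀ v ∈ ID n,
        u * v ∈ (Submodule.span K {z | ∃ v' ∈ ID n, ∃ u' ∈ TXs n, z = v' * u'}) ⊔ IDX n) ∧
    (∀ u ∈ IX n, ∀ v ∈ TDs n,
        u * v ∈ (Submodule.span K {z | ∃ d ∈ TDs n, ∃ w ∈ IX n, z = d * w}) ⊔ IDX n) := by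
  have hDX := relDX_quotDX (n := n)
  have hst := entries_mul_entries_le_of_relDX hDX
  constructor
  · intro u hu v hv
    refine mem_sup_IDX ?_
    have hspan : Submodule.span K {z | ∃ v' ∈ ID n, ∃ u' ∈ TXs n, z = v' * u'} =
        ID n * gen (entrySet (xF n)) :=
      (mul_eq_span (ID n) (gen (entrySet (xF n)))).symm
    have huv := Submodule.mem_map_of_mem (f := (quotDX n).toLinearMap)
      (Submodule.mul_mem_mul (show u ∈ gen (entrySet (xF n)) from hu) hv)
    rw [ID_eq] at huv
    rw [hspan, ID_eq]
    simp only [Submodule.map_mul, map_gen, image_entrySet, map_entries, map_relD] at huv ⊢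
    exact gen_mul_ideal_le hst (entries_mul_entries_relD_le hDX) huv
  · intro u hu v hv
    refine mem_sup_IDX ?_
    have hspan : Submodule.span K {z | ∃ d ∈ TDs n, ∃ w ∈ IX n, z = d * w} =
        gen (entrySet (dF n)) * IX n :=
      (mul_eq_span (gen (entrySet (dF n))) (IX n)).symm
    have huv := Submodule.mem_map_of_mem (f := (quotDX n).toLinearMap)
      (Submodule.mul_mem_mul hu (show v ∈ gen (entrySet (dF n)) from hv))
    rw [IX_eq] at huv
    rw [hspan, IX_eq]
    simp only [Submodule.map_mul, map_gen, image_entrySet, map_entries, map_relX] at huv ⊢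
    exact ideal_mul_gen_le hst (entries_relX_mul_entries_le hDX) huv

end Statement14
end
end
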